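/- Fix a real T > 1. For every sufficiently large prime d (in terms of T), there exists a prime p with T^d < p < 2T^d and p ≡ d − 1 (mod d^2). -/

import Mathlib

section

open Finset Filter Topology

lemma sum_Ico_sub_succ (f : ℕ → ℝ) {N M : ℕ} (hM : N ≤ M) :
    ∑ n ∈ Ico N M, (f n - f (n + 1)) = f N - f M := by
  induction M, hM using Nat.le_induction with
  | base => simp
  | succ M hM ih => rw [sum_Ico_succ_top hM, ih]; ring

lemma norm_sum_mul_le_of_partial_sums {c g : ℕ → ℂ} {S : ℝ} {N : ℕ}
    (hc : ∀ m, N ≤ m → ‖∑ n ∈ Ico N m, c n‖ ≤ S) {M : ℕ} (hM : N ≤ M) :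
    ‖∑ n ∈ Ico N M, c n * g n‖ ≤ S * (‖g M‖ + ∑ n ∈ Ico N M, ‖g (n + 1) - g n‖) := by
  have key : ∑ n ∈ Ico N M, c n * g n = (∑ n ∈ Ico N M, c n) * g M
      - ∑ n ∈ Ico N M, (∑ k ∈ Ico N (n + 1), c k) * (g (n + 1) - g n) := by
    induction M, hM using Nat.le_induction with
    | base => simp
    | succ M hM ih =>
      simp only [sum_Ico_succ_top hM, ih]
      ring
  rw [key, mul_add, mul_sum]
  refine (norm_sub_le _ _).trans (add_le_add ?_ ((norm_sum_le _ _).trans (sum_le_sum ?_)))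
  · rw [norm_mul]
    gcongr
    exact hc M hM
  · intro n hn
    rw [norm_mul]
    gcongr
    exact hc _ (by have := (mem_Ico.mp hn).1; omega)

lemma norm_natCast_cpow_succ_sub_le {s : ℂ} (hs : 0 < s.re) {n : ℕ} (hn : 1 ≤ n) :
    ‖((n + 1 : ℕ) : ℂ) ^ (-s) - (n : ℂ) ^ (-s)‖ ≤
      ‖s‖ / s.re * ((n : ℝ) ^ (-s.re) - ((n + 1 : ℕ) : ℝ) ^ (-s.re)) := by
  have hs0 : s ≠ 0 := by rintro rfl; simp at hs
  have hn' : (0 : ℝ) < n := by exact_mod_cast hn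
  have h0 : (0 : ℝ) ∉ Set.uIcc (n : ℝ) ((n + 1 : ℕ) : ℝ) := by
    rw [Set.uIcc_of_le (by push_cast; linarith)]
    simp only [Set.mem_Icc, not_and_or, not_le]; left; exact hn'
  have hI : ∫ u in (n : ℝ)..((n + 1 : ℕ) : ℝ), (u : ℂ) ^ (-s - 1) =
      (((n + 1 : ℕ) : ℂ) ^ (-s) - (n : ℂ) ^ (-s)) / (-s) := by
    have := integral_cpow (a := (n : ℝ)) (b := ((n + 1 : ℕ) : ℝ)) (r := -s - 1)
      (Or.inr ⟨by intro h; apply hs0; linear_combination -h, h0⟩)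
    simpa using this
  have hR : ∫ u in (n : ℝ)..((n + 1 : ℕ) : ℝ), u ^ (-s.re - 1) =
      (((n + 1 : ℕ) : ℝ) ^ (-s.re) - (n : ℝ) ^ (-s.re)) / (-s.re) := by
    have := integral_rpow (a := (n : ℝ)) (b := ((n + 1 : ℕ) : ℝ)) (r := -s.re - 1)
      (Or.inr ⟨by intro h; linarith, h0⟩)
    simpa using this
  have hle : ‖∫ u in (n : ℝ)..((n + 1 : ℕ) : ℝ), (u : ℂ) ^ (-s - 1)‖ ≤
      ∫ u in (n : ℝ)..((n + 1 : ℕ) : ℝ), u ^ (-s.re - 1) := by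
    refine (intervalIntegral.norm_integral_le_integral_norm (by push_cast; linarith)).trans_eq ?_
    refine intervalIntegral.integral_congr fun u hu => ?_
    rw [Set.uIcc_of_le (by push_cast; linarith)] at hu
    simp [Complex.norm_cpow_eq_rpow_re_of_pos (hn'.trans_le hu.1)]
  rw [hI, hR, norm_div, norm_neg] at hle
  have h1 : ‖((n + 1 : ℕ) : ℂ) ^ (-s) - (n : ℂ) ^ (-s)‖ ≤ ‖s‖ *
      ((((n + 1 : ℕ) : ℝ) ^ (-s.re) - (n : ℝ) ^ (-s.re)) / (-s.re)) := by
    rwa [div_le_iff₀' (norm_pos_iff.mpr hs0)] at hle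
  refine h1.trans_eq ?_
  field_simp
  ring

/-- Tail bound for Dirichlet series with bounded partial sums. -/
lemma norm_sum_Ico_mul_cpow_le {c : ℕ → ℂ} {S : ℝ} {N M : ℕ} (hN : 1 ≤ N) (hM : N ≤ M)
    (hc : ∀ m, N ≤ m → ‖∑ n ∈ Ico N m, c n‖ ≤ S) {s : ℂ} (hs : 0 < s.re) :
    ‖∑ n ∈ Ico N M, c n * (n : ℂ) ^ (-s)‖ ≤ S * (‖s‖ / s.re * (N : ℝ) ^ (-s.re)) := by
  have hS : 0 ≤ S := (norm_nonneg _).trans (hc N le_rfl)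
  refine (norm_sum_mul_le_of_partial_sums hc hM).trans (mul_le_mul_of_nonneg_left ?_ hS)
  have h1 : ∑ n ∈ Ico N M, ‖((n + 1 : ℕ) : ℂ) ^ (-s) - (n : ℂ) ^ (-s)‖ ≤
      ‖s‖ / s.re * ((N : ℝ) ^ (-s.re) - (M : ℝ) ^ (-s.re)) := by
    have := sum_Ico_sub_succ (fun n : ℕ => (n : ℝ) ^ (-s.re)) hM
    rw [← this, mul_sum]
    exact sum_le_sum fun n hn =>
      norm_natCast_cpow_succ_sub_le hs (hN.trans (mem_Ico.mp hn).1)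
  have hM0 : (0 : ℝ) < M := by exact_mod_cast hN.trans hM
  have h2 : ‖(M : ℂ) ^ (-s)‖ = (M : ℝ) ^ (-s.re) := by
    rw [Complex.norm_natCast_cpow_of_pos (hN.trans hM), Complex.neg_re]
  have h3 : 1 ≤ ‖s‖ / s.re := by
    rw [le_div_iff₀ hs, one_mul]; exact Complex.re_le_norm s
  have h4 : (0 : ℝ) ≤ (M : ℝ) ^ (-s.re) := by positivity
  rw [h2]
  nlinarith

lemma norm_sum_range_char_le {q : ℕ} [NeZero q] {χ : DirichletCharacter ℂ q} (hχ : χ ≠ 1) (m : ℕ) :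
    ‖∑ n ∈ range m, χ n‖ ≤ q := by
  have hper : ∀ k, ∑ n ∈ range (q * k), χ n = 0 := by
    intro k
    induction k with
    | zero => simp
    | succ k ih =>
      rw [mul_add, mul_one, sum_range_add, ih, zero_add]
      have : ∑ x ∈ range q, χ ((q * k + x : ℕ) : ZMod q) = ∑ x ∈ range q, χ (x : ZMod q) := by
        refine sum_congr rfl fun x _ => ?_
        push_cast; simp
      rw [this, ← MulChar.sum_eq_zero_of_ne_one hχ]
      refine Finset.sum_nbij' (fun n : ℕ => (n : ZMod q)) ZMod.val ?_ ?_ ?_ ?_ ?_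
      · simp
      · intro a _; simpa using ZMod.val_lt a
      · intro a ha; exact ZMod.val_cast_of_lt (by simpa using ha)
      · intro a _; simp
      · simp
  have : ∑ n ∈ range m, χ n = ∑ n ∈ range (m % q), χ ((q * (m / q) + n : ℕ) : ZMod q) := by
    conv_lhs => rw [← Nat.div_add_mod m q]
    rw [sum_range_add, hper, zero_add]
  rw [this]
  refine (norm_sum_le _ _).trans ((sum_le_sum fun n _ => χ.norm_le_one _).trans ?_)
  simp only [sum_const, card_range, nsmul_eq_mul, mul_one]
  exact_mod_cast (Nat.mod_lt m (Nat.pos_of_neZero q)).le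

lemma norm_sum_Ico_le_two_mul {c : ℕ → ℂ} {S : ℝ} (hc : ∀ m, ‖∑ n ∈ range m, c n‖ ≤ S)
    {N m : ℕ} (h : N ≤ m) : ‖∑ n ∈ Ico N m, c n‖ ≤ 2 * S := by
  rw [sum_Ico_eq_sub _ h]
  linarith [norm_sub_le (∑ n ∈ range m, c n) (∑ n ∈ range N, c n), hc m, hc N]

lemma lseries_term_eq_mul_cpow (f : ℕ → ℂ) {s : ℂ} (hs : s ≠ 0) (n : ℕ) :
    LSeries.term f s n = f n * (n : ℂ) ^ (-s) := by
  rcases eq_or_ne n 0 with rfl | hn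
  · simp [Complex.zero_cpow (neg_ne_zero.mpr hs)]
  · rw [LSeries.term_of_ne_zero hn, Complex.cpow_neg, div_eq_mul_inv]

/-- A Dirichlet `L`-function of a nontrivial character is approximated in the right half plane by
the partial sums of its Dirichlet series. -/
lemma norm_LFunction_sub_sum_le {q : ℕ} [NeZero q] {χ : DirichletCharacter ℂ q} (hχ : χ ≠ 1)
    {S : ℝ} (hS : ∀ m, ‖∑ n ∈ range m, χ n‖ ≤ S) {s : ℂ} (hs : 0 < s.re) {N : ℕ} (hN : 1 ≤ N) :
    ‖χ.LFunction s - ∑ n ∈ range N, χ n * (n : ℂ) ^ (-s)‖ ≤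
      2 * S * (‖s‖ / s.re * (N : ℝ) ^ (-s.re)) := by
  have hS0 : 0 ≤ S := (norm_nonneg _).trans (hS 0)
  set P : ℕ → ℂ → ℂ := fun M z => ∑ n ∈ range M, χ n * (n : ℂ) ^ (-z) with hP
  have hPdiff : ∀ {z : ℂ}, 0 < z.re → ∀ {N M : ℕ}, 1 ≤ N → N ≤ M →
      ‖P M z - P N z‖ ≤ 2 * S * (‖z‖ / z.re * (N : ℝ) ^ (-z.re)) := by
    intro z hz N M hN hM
    simp only [hP]
    rw [← sum_Ico_eq_sub _ hM]
    exact norm_sum_Ico_mul_cpow_le hN hM (fun m hm => norm_sum_Ico_le_two_mul hS hm) hz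
  set r : ℝ := max 3 (‖s‖ + 1 + 1 / s.re) with hr
  have hr3 : 3 ≤ r := le_max_left _ _
  have hrs : ‖s‖ + 1 + 1 / s.re ≤ r := le_max_right _ _
  set U : Set ℂ := {z | 1 / (2 * r) < z.re} ∩ Metric.ball 0 r with hU
  have hUo : IsOpen U := (isOpen_lt continuous_const Complex.continuous_re).inter Metric.isOpen_ball
  have hUc : IsPreconnected U :=
    ((convex_halfSpace_re_gt _).inter (convex_ball _ _)).isPreconnected
  have hUre : ∀ z ∈ U, 1 / (2 * r) < z.re := fun z hz => hz.1
  have hUpos : ∀ z ∈ U, 0 < z.re := fun z hz => lt_trans (by positivity) (hUre z hz)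
  have hUn : ∀ z ∈ U, ‖z‖ < r := fun z hz => by simpa using hz.2
  have hsU : s ∈ U := by
    refine ⟨?_, ?_⟩
    · have : 1 / s.re < 2 * r := by
        have := norm_nonneg s
        linarith
      rw [Set.mem_ofPred_eq, div_lt_iff₀ (by positivity)]
      rw [div_lt_iff₀ hs] at this
      linarith
    · have : 0 < 1 / s.re := by positivity
      simp only [Metric.mem_ball, dist_zero_right]
      linarith
  have h2U : (2 : ℂ) ∈ U := by
    refine ⟨?_, ?_⟩
    · simp only [Set.mem_ofPred_eq, Complex.re_ofNat]
      rw [div_lt_iff₀ (by positivity)]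
      linarith
    · simp only [Metric.mem_ball, dist_zero_right, Complex.norm_ofNat]
      linarith
  have hunif : ∀ z ∈ U, ∀ {N M : ℕ}, 1 ≤ N → N ≤ M →
      ‖P M z - P N z‖ ≤ 2 * S * (r * (2 * r) * (N : ℝ) ^ (-(1 / (2 * r)))) := by
    intro z hz N M hN hM
    refine (hPdiff (hUpos z hz) hN hM).trans ?_
    have h1 : ‖z‖ / z.re ≤ r * (2 * r) := by
      rw [div_le_iff₀ (hUpos z hz)]
      have h2 := hUre z hz
      rw [div_lt_iff₀ (by positivity)] at h2
      nlinarith [hUn z hz]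
    have h3 : (N : ℝ) ^ (-z.re) ≤ (N : ℝ) ^ (-(1 / (2 * r))) :=
      Real.rpow_le_rpow_of_exponent_le (by exact_mod_cast hN) (by linarith [hUre z hz])
    gcongr
  have hlim0 : Tendsto (fun N : ℕ => 2 * S * (r * (2 * r) * (N : ℝ) ^ (-(1 / (2 * r)))))
      atTop (𝓝 0) := by
    have := ((tendsto_rpow_neg_atTop (y := 1 / (2 * r)) (by positivity)).comp
      tendsto_natCast_atTop_atTop).const_mul (r * (2 * r)) |>.const_mul (2 * S)
    simpa using this
  have hcauchy : UniformCauchySeqOn P atTop U := by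
    rw [Metric.uniformCauchySeqOn_iff]
    intro ε hε
    obtain ⟨N₀, hN₀⟩ := ((hlim0.eventually (gt_mem_nhds (half_pos hε))).and
      (eventually_ge_atTop 1)).exists
    refine ⟨N₀, fun m hm n hn z hz => ?_⟩
    have h1 := hunif z hz hN₀.2 hm
    have h2 := hunif z hz hN₀.2 hn
    have h3 := dist_triangle_right (P m z) (P n z) (P N₀ z)
    rw [dist_eq_norm (P m z) (P N₀ z), dist_eq_norm (P n z)] at h3
    linarith [hN₀.1]
  have hpt : ∀ z ∈ U, ∃ l, Tendsto (fun M => P M z) atTop (𝓝 l) := fun z hz =>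
    cauchySeq_tendsto_of_complete (hcauchy.cauchySeq hz)
  choose! g hg using hpt
  have hgU : TendstoUniformlyOn P g atTop U := hcauchy.tendstoUniformlyOn_of_tendsto hg
  have hPd : ∀ M, DifferentiableOn ℂ (P M) U := by
    intro M
    simp only [hP]
    refine DifferentiableOn.fun_sum fun n _ => ?_
    intro z hz
    rcases eq_or_ne n 0 with rfl | hn
    · have : (fun z : ℂ => χ ((0 : ℕ) : ZMod q) * ((0 : ℕ) : ℂ) ^ (-z)) =ᶠ[𝓝 z] fun _ => 0 := by
        filter_upwards [hUo.mem_nhds hz] with w hw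
        have : w ≠ 0 := by
          rintro rfl; simpa using hUpos 0 hw
        simp [Complex.zero_cpow (neg_ne_zero.mpr this)]
      exact (this.differentiableAt_iff.mpr (differentiableAt_const _)).differentiableWithinAt
    · refine DifferentiableAt.differentiableWithinAt ?_
      have hn' : (n : ℂ) ≠ 0 := by exact_mod_cast hn
      exact ((differentiableAt_id.neg).const_cpow (Or.inl hn')).const_mul _
  have hgd : DifferentiableOn ℂ g U :=
    hgU.tendstoLocallyUniformlyOn.differentiableOn (Eventually.of_forall hPd) hUo
  have heq : Set.EqOn χ.LFunction g U := by
    refine AnalyticOnNhd.eqOn_of_preconnected_of_eventuallyEq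
      ((DirichletCharacter.differentiable_LFunction hχ).differentiableOn.analyticOnNhd hUo)
      (hgd.analyticOnNhd hUo) hUc h2U ?_
    filter_upwards [hUo.mem_nhds h2U, (isOpen_lt continuous_const Complex.continuous_re).mem_nhds
      (show (1 : ℝ) < (2 : ℂ).re by norm_num)] with z hzU hz1
    refine tendsto_nhds_unique ?_ (hg z hzU)
    rw [DirichletCharacter.LFunction_eq_LSeries χ hz1]
    have hz0 : z ≠ 0 := by rintro rfl; simpa using hUpos 0 hzU
    have := (DirichletCharacter.LSeriesSummable_of_one_lt_re χ hz1).hasSum.tendsto_sum_nat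
    exact this.congr fun M => sum_congr rfl fun n _ => lseries_term_eq_mul_cpow _ hz0 n
  rw [heq hsU]
  refine le_of_tendsto (((hg s hsU).sub_const (P N s)).norm) ?_
  filter_upwards [eventually_ge_atTop N] with M hM using hPdiff hs hN hM

lemma sum_range_norm_cpow_le {c : ℕ → ℂ} (hc : ∀ n, ‖c n‖ ≤ 1) {δ : ℝ} (hδ : 0 ≤ δ) {s : ℂ}
    (hs : 1 - δ ≤ s.re) (hs0 : 0 < s.re) {N : ℕ} (hN : 1 ≤ N) :
    ‖∑ n ∈ range N, c n * (n : ℂ) ^ (-s)‖ ≤ (N : ℝ) ^ δ * (1 + Real.log N) := by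
  have hs1 : s ≠ 0 := by rintro rfl; simp at hs0
  have h1 : ∀ n ∈ range N, ‖c n * (n : ℂ) ^ (-s)‖ ≤ (N : ℝ) ^ δ * ((n : ℝ))⁻¹ := by
    intro n hn
    rcases eq_or_ne n 0 with rfl | hn0
    · simp [Complex.zero_cpow (neg_ne_zero.mpr hs1)]
    · have hn1 : (1 : ℝ) ≤ n := by exact_mod_cast Nat.one_le_iff_ne_zero.mpr hn0
      rw [norm_mul, Complex.norm_natCast_cpow_of_pos (Nat.pos_of_ne_zero hn0), Complex.neg_re]
      calc ‖c n‖ * (n : ℝ) ^ (-s.re) ≤ 1 * (n : ℝ) ^ (δ - 1) := by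
            gcongr
            · exact hc n
            · linarith
        _ = (n : ℝ) ^ δ * ((n : ℝ))⁻¹ := by
            rw [one_mul, Real.rpow_sub_one (by positivity), div_eq_mul_inv]
        _ ≤ _ := by
            gcongr
            exact (mem_range.mp hn).le
  refine (norm_sum_le _ _).trans ((sum_le_sum h1).trans ?_)
  rw [← mul_sum]
  gcongr
  have h2 : ∑ n ∈ range N, ((n : ℝ))⁻¹ ≤ (harmonic N : ℝ) := by
    rw [harmonic]
    push_cast
    obtain ⟨k, rfl⟩ : ∃ k, N = k + 1 := ⟨N - 1, by omega⟩
    rw [sum_range_succ', sum_range_succ]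
    simp only [Nat.cast_zero, inv_zero, add_zero]
    push_cast
    have : (0 : ℝ) ≤ ((k : ℝ) + 1)⁻¹ := by positivity
    linarith
  exact h2.trans (harmonic_le_one_add_log N)

lemma norm_LFunction_le {q : ℕ} [NeZero q] {χ : DirichletCharacter ℂ q} (hχ : χ ≠ 1)
    {δ : ℝ} (hδ : 0 ≤ δ) {s : ℂ} (hs : 1 - δ ≤ s.re) (hs0 : 1 / 2 ≤ s.re) {N : ℕ} (hN : 1 ≤ N) :
    ‖χ.LFunction s‖ ≤ (N : ℝ) ^ δ * (1 + Real.log N) + 4 * q * ‖s‖ * ((N : ℝ) ^ δ / N) := by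
  have h1 := norm_LFunction_sub_sum_le hχ (norm_sum_range_char_le hχ) (by linarith : 0 < s.re) hN
  have h2 := sum_range_norm_cpow_le (c := fun n => χ n) (fun n => χ.norm_le_one _) hδ hs
    (by linarith) hN
  have hN0 : (1 : ℝ) ≤ N := by exact_mod_cast hN
  have h3 : (N : ℝ) ^ (-s.re) ≤ (N : ℝ) ^ δ / N := by
    rw [← Real.rpow_sub_one (by positivity)]
    exact Real.rpow_le_rpow_of_exponent_le hN0 (by linarith)
  have h4 : ‖s‖ / s.re ≤ 2 * ‖s‖ := by
    rw [div_le_iff₀ (by linarith)]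
    nlinarith [norm_nonneg s]
  have h5 : 2 * (q : ℝ) * (‖s‖ / s.re * (N : ℝ) ^ (-s.re)) ≤
      2 * q * (2 * ‖s‖ * ((N : ℝ) ^ δ / N)) := by gcongr
  have h6 := norm_sub_norm_le (χ.LFunction s) (∑ n ∈ range N, χ n * (n : ℂ) ^ (-s))
  linarith

lemma eventually_rpow_mul_log_le {a b : ℝ} (hab : a < b) (A B : ℝ) :
    ∀ᶠ d : ℕ in atTop, (d : ℝ) ^ a * (A + B * Real.log d) ≤ (d : ℝ) ^ b := by
  have h1 : (fun x : ℝ => A + B * Real.log x) =o[atTop] fun x => x ^ (b - a) := by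
    refine Asymptotics.IsLittleO.add ?_ ((isLittleO_log_rpow_atTop (by linarith)).const_mul_left B)
    exact (Asymptotics.isLittleO_const_left).mpr
      (Or.inr (tendsto_norm_atTop_atTop.comp (tendsto_rpow_atTop (by linarith))))
  have h2 := (h1.bound one_pos).and (eventually_gt_atTop 0)
  filter_upwards [tendsto_natCast_atTop_atTop.eventually h2] with d hd
  obtain ⟨hd, hd0⟩ := hd
  rw [one_mul, Real.norm_of_nonneg (by positivity : (0 : ℝ) ≤ (d : ℝ) ^ (b - a))] at hd
  calc (d : ℝ) ^ a * (A + B * Real.log d) ≤ (d : ℝ) ^ a * (d : ℝ) ^ (b - a) := by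
        gcongr; exact (le_abs_self _).trans hd
    _ = (d : ℝ) ^ b := by rw [← Real.rpow_add hd0]; congr 1; ring

lemma eventually_norm_LFunction_le : ∀ᶠ d : ℕ in atTop, ∀ [NeZero (d ^ 2)],
    ∀ χ : DirichletCharacter ℂ (d ^ 2), χ ≠ 1 → ∀ s : ℂ, 1 - 1 / 400 ≤ s.re → s.re ≤ 3 →
      |s.im| ≤ 3 * (d : ℝ) ^ 10 → ‖χ.LFunction s‖ ≤ (d : ℝ) ^ (1 / 20 : ℝ) / 1000 := by
  filter_upwards [eventually_rpow_mul_log_le (show (1 / 25 : ℝ) < 1 / 20 by norm_num) 25000 16000,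
    eventually_ge_atTop 2] with d hd hd2 _ χ hχ s hs1 hs3 ht
  have hd2' : (2 : ℝ) ≤ d := by exact_mod_cast hd2
  have hd0 : (0 : ℝ) < d := by linarith
  have h1 := norm_LFunction_le hχ (by norm_num : (0 : ℝ) ≤ 1 / 400) hs1 (by linarith)
    (N := d ^ 16) (Nat.one_le_pow _ _ (by omega))
  have h2 : ((d ^ 16 : ℕ) : ℝ) ^ (1 / 400 : ℝ) = (d : ℝ) ^ (1 / 25 : ℝ) := by
    push_cast
    rw [← Real.rpow_natCast, ← Real.rpow_mul hd0.le]
    norm_num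
  have h3 : ‖s‖ ≤ 6 * (d : ℝ) ^ 10 := by
    have := Complex.norm_le_abs_re_add_abs_im s
    rw [abs_of_nonneg (by linarith : 0 ≤ s.re)] at this
    have : (1 : ℝ) ≤ (d : ℝ) ^ 10 := one_le_pow₀ (by linarith)
    linarith
  have h4 : 4 * ((d ^ 2 : ℕ) : ℝ) * ‖s‖ * ((d : ℝ) ^ (1 / 25 : ℝ) / ((d ^ 16 : ℕ) : ℝ)) ≤
      24 * (d : ℝ) ^ (1 / 25 : ℝ) := by
    push_cast
    calc _ ≤ 4 * (d : ℝ) ^ 2 * (6 * (d : ℝ) ^ 10) * ((d : ℝ) ^ (1 / 25 : ℝ) / (d : ℝ) ^ 16) := by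
          gcongr
      _ = 24 * (d : ℝ) ^ (1 / 25 : ℝ) * (1 / (d : ℝ) ^ 4) := by field_simp; norm_num
      _ ≤ 24 * (d : ℝ) ^ (1 / 25 : ℝ) * 1 := by
          gcongr
          rw [div_le_one (by positivity)]
          exact one_le_pow₀ (by linarith)
      _ = _ := mul_one _
  have h5 : Real.log ((d ^ 16 : ℕ) : ℝ) = 16 * Real.log d := by push_cast; rw [Real.log_pow]; norm_num
  rw [h2, h5] at h1
  linarith

lemma eventually_norm_deriv_LFunction_le : ∀ᶠ d : ℕ in atTop, ∀ [NeZero (d ^ 2)],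
    ∀ χ : DirichletCharacter ℂ (d ^ 2), χ ≠ 1 → ∀ s : ℂ, 1 - 1 / 800 ≤ s.re → s.re ≤ 2 →
      |s.im| ≤ 2 * (d : ℝ) ^ 10 → ‖deriv χ.LFunction s‖ ≤ (d : ℝ) ^ (1 / 20 : ℝ) := by
  filter_upwards [eventually_norm_LFunction_le, eventually_ge_atTop 1] with d hd hd1 _ χ hχ s h1 h2 h3
  have hd1' : (1 : ℝ) ≤ (d : ℝ) ^ 10 := one_le_pow₀ (by exact_mod_cast hd1)
  have := Complex.norm_deriv_le_of_forall_mem_sphere_norm_le (c := s) (R := 1 / 800)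
    (f := χ.LFunction) (C := (d : ℝ) ^ (1 / 20 : ℝ) / 1000) (by norm_num)
    (DirichletCharacter.differentiable_LFunction hχ).diffContOnCl (fun z hz => by
      have hz' : ‖z - s‖ = 1 / 800 := by simpa [dist_eq_norm] using hz
      have hre := (Complex.abs_re_le_norm (z - s)).trans_eq hz'
      have him := (Complex.abs_im_le_norm (z - s)).trans_eq hz'
      rw [Complex.sub_re, abs_le] at hre
      rw [Complex.sub_im] at him
      have := abs_sub_abs_le_abs_sub z.im s.im
      exact hd χ hχ z (by linarith) (by linarith) (by linarith))
  have h4 : (0 : ℝ) ≤ (d : ℝ) ^ (1 / 20 : ℝ) := by positivity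
  refine this.trans ?_
  linarith

lemma norm_natCast_cpow_sub_integral_le {s : ℂ} (hs : 1 < s.re) {n : ℕ} (hn : 1 ≤ n) :
    ‖(n : ℂ) ^ (-s) - ((n : ℂ) ^ (1 - s) - ((n + 1 : ℕ) : ℂ) ^ (1 - s)) / (s - 1)‖ ≤
      ‖s‖ * (2 * ((n : ℝ)⁻¹ - ((n + 1 : ℕ) : ℝ)⁻¹)) := by
  have hn' : (1 : ℝ) ≤ n := by exact_mod_cast hn
  have hs1 : s - 1 ≠ 0 := by intro h; rw [sub_eq_zero] at h; rw [h] at hs; simp at hs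
  have h0 : (0 : ℝ) ∉ Set.uIcc (n : ℝ) ((n + 1 : ℕ) : ℝ) := by
    rw [Set.uIcc_of_le (by push_cast; linarith)]
    simp only [Set.mem_Icc, not_and_or, not_le]; left; linarith
  have hI : ∫ u in (n : ℝ)..((n + 1 : ℕ) : ℝ), (u : ℂ) ^ (-s) =
      ((n : ℂ) ^ (1 - s) - ((n + 1 : ℕ) : ℂ) ^ (1 - s)) / (s - 1) := by
    have := integral_cpow (a := (n : ℝ)) (b := ((n + 1 : ℕ) : ℝ)) (r := -s)
      (Or.inr ⟨by intro h; apply hs1; linear_combination -h, h0⟩)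
    rw [this]
    rw [show -s + 1 = 1 - s by ring, ← neg_sub s 1, div_neg, ← neg_div, neg_sub]
    simp
  have hInt : IntervalIntegrable (fun u : ℝ => (u : ℂ) ^ (-s)) MeasureTheory.volume (n : ℝ)
      ((n + 1 : ℕ) : ℝ) := intervalIntegral.intervalIntegrable_cpow (Or.inr h0)
  have hc : (n : ℂ) ^ (-s) = ∫ u in (n : ℝ)..((n + 1 : ℕ) : ℝ), (n : ℂ) ^ (-s) := by simp
  have hsum : (n : ℂ) ^ (-s) - ((n : ℂ) ^ (1 - s) - ((n + 1 : ℕ) : ℂ) ^ (1 - s)) / (s - 1) =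
      ∫ u in (n : ℝ)..((n + 1 : ℕ) : ℝ), ((n : ℂ) ^ (-s) - (u : ℂ) ^ (-s)) := by
    rw [intervalIntegral.integral_sub (by simp) hInt, hI, ← hc]
  rw [hsum]
  have hb : ∀ u ∈ Set.uIoc (n : ℝ) ((n + 1 : ℕ) : ℝ), ‖(n : ℂ) ^ (-s) - (u : ℂ) ^ (-s)‖ ≤
      ‖s‖ * ((n : ℝ) ^ 2)⁻¹ := by
    intro u hu
    rw [Set.uIoc_of_le (by push_cast; linarith)] at hu
    obtain ⟨hu1, hu2⟩ := hu
    push_cast at hu2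
    have hder : ∀ x ∈ Set.Icc (n : ℝ) u, HasDerivWithinAt (fun x : ℝ => (x : ℂ) ^ (-s))
        (-s * (x : ℂ) ^ (-s - 1)) (Set.Icc (n : ℝ) u) x := by
      intro x hx
      have hx0 : 0 < x := by linarith [hx.1]
      have := hasDerivAt_ofReal_cpow_const' (x := x) (r := -s - 1) hx0.ne' (by
        intro h; apply Complex.ne_zero_of_re_pos (lt_trans one_pos hs); linear_combination -h)
      have h2 := this.const_mul (-s)
      have hs0 : s ≠ 0 := Complex.ne_zero_of_re_pos (lt_trans one_pos hs)
      refine (h2.congr_of_eventuallyEq ?_).hasDerivWithinAt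
      filter_upwards with y
      rw [sub_add_cancel]
      field_simp
    have hbd : ∀ x ∈ Set.Icc (n : ℝ) u, ‖-s * (x : ℂ) ^ (-s - 1)‖ ≤ ‖s‖ * ((n : ℝ) ^ 2)⁻¹ := by
      intro x hx
      have hx0 : 0 < x := by linarith [hx.1]
      rw [norm_mul, norm_neg, Complex.norm_cpow_eq_rpow_re_of_pos hx0]
      gcongr
      calc x ^ (-s - 1).re ≤ x ^ (-2 : ℝ) := by
            refine Real.rpow_le_rpow_of_exponent_le (by linarith [hx.1]) ?_
            simp; linarith
        _ = (x ^ 2)⁻¹ := by rw [Real.rpow_neg hx0.le]; norm_num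
        _ ≤ _ := by gcongr; exact hx.1
    have := (convex_Icc (n : ℝ) u).norm_image_sub_le_of_norm_hasDerivWithin_le hder hbd
      (Set.right_mem_Icc.mpr hu1.le) (Set.left_mem_Icc.mpr hu1.le)
    simp only [Complex.ofReal_natCast] at this
    refine this.trans ?_
    rw [Real.norm_eq_abs, abs_of_nonpos (by linarith)]
    have h0 : 0 ≤ ‖s‖ * ((n : ℝ) ^ 2)⁻¹ := by positivity
    nlinarith
  refine (intervalIntegral.norm_integral_le_of_norm_le_const hb).trans ?_
  push_cast
  rw [add_sub_cancel_left, abs_one, mul_one]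
  gcongr
  rw [inv_sub_inv (by positivity) (by positivity), add_sub_cancel_left, inv_eq_one_div, ← mul_div_assoc,
    mul_one, div_le_div_iff₀ (by positivity) (by positivity)]
  nlinarith

lemma norm_riemannZeta_le {s : ℂ} (hs : 1 < s.re) {N : ℕ} (hN : 1 ≤ N) :
    ‖riemannZeta s‖ ≤ 1 + Real.log N + 2 / ‖s - 1‖ + 2 * ‖s‖ / N := by
  have hN0 : (1 : ℝ) ≤ N := by exact_mod_cast hN
  have hs0 : s ≠ 0 := Complex.ne_zero_of_re_pos (lt_trans one_pos hs)
  have hlim : Tendsto (fun M => ∑ n ∈ range M, (n : ℂ) ^ (-s)) atTop (𝓝 (riemannZeta s)) := by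
    have := (LSeriesSummable_one_iff.mpr hs).hasSum.tendsto_sum_nat
    rw [← LSeries_one_eq_riemannZeta hs]
    refine this.congr fun M => sum_congr rfl fun n _ => ?_
    rw [lseries_term_eq_mul_cpow _ hs0]; simp
  refine le_of_tendsto hlim.norm ?_
  filter_upwards [eventually_ge_atTop N] with M hM
  have h1 := sum_range_norm_cpow_le (c := fun _ => 1) (by simp) le_rfl (by linarith) (by linarith) hN
  simp only [one_mul, Real.rpow_zero] at h1
  have htel : ∑ n ∈ Ico N M, ((n : ℂ) ^ (1 - s) - ((n + 1 : ℕ) : ℂ) ^ (1 - s)) / (s - 1) =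
      ((N : ℂ) ^ (1 - s) - (M : ℂ) ^ (1 - s)) / (s - 1) := by
    clear h1
    induction M, hM using Nat.le_induction with
    | base => simp
    | succ M hM ih => rw [sum_Ico_succ_top hM, ih]; ring
  have hone : ∀ k : ℕ, 1 ≤ k → ‖(k : ℂ) ^ (1 - s)‖ ≤ 1 := by
    intro k hk
    rw [Complex.norm_natCast_cpow_of_pos hk]
    refine Real.rpow_le_one_of_one_le_of_nonpos (by exact_mod_cast hk) ?_
    simp; linarith
  have h2 : ‖((N : ℂ) ^ (1 - s) - (M : ℂ) ^ (1 - s)) / (s - 1)‖ ≤ 2 / ‖s - 1‖ := by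
    rw [norm_div]
    have := norm_sub_le ((N : ℂ) ^ (1 - s)) ((M : ℂ) ^ (1 - s))
    gcongr
    linarith [hone N hN, hone M (hN.trans hM)]
  have h3 : ‖∑ n ∈ Ico N M, ((n : ℂ) ^ (-s) -
      ((n : ℂ) ^ (1 - s) - ((n + 1 : ℕ) : ℂ) ^ (1 - s)) / (s - 1))‖ ≤ 2 * ‖s‖ / N := by
    refine (norm_sum_le _ _).trans ((sum_le_sum fun n hn =>
      norm_natCast_cpow_sub_integral_le hs (hN.trans (mem_Ico.mp hn).1)).trans ?_)
    rw [← mul_sum, ← mul_sum, sum_Ico_sub_succ (fun n : ℕ => (n : ℝ)⁻¹) hM]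
    have : (0 : ℝ) ≤ (M : ℝ)⁻¹ := by positivity
    have h5 := norm_nonneg s
    rw [div_eq_mul_inv]
    nlinarith
  have h4 : ∑ n ∈ range M, (n : ℂ) ^ (-s) = ∑ n ∈ range N, (n : ℂ) ^ (-s) +
      ∑ n ∈ Ico N M, ((n : ℂ) ^ (-s) -
      ((n : ℂ) ^ (1 - s) - ((n + 1 : ℕ) : ℂ) ^ (1 - s)) / (s - 1)) +
      ((N : ℂ) ^ (1 - s) - (M : ℂ) ^ (1 - s)) / (s - 1) := by
    rw [← htel, add_assoc, ← sum_add_distrib]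
    simp only [sub_add_cancel]
    rw [sum_range_add_sum_Ico _ hM]
  rw [h4]
  refine (norm_add_le _ _).trans ?_
  linarith [norm_add_le (∑ n ∈ range N, (n : ℂ) ^ (-s)) (∑ n ∈ Ico N M, ((n : ℂ) ^ (-s) -
      ((n : ℂ) ^ (1 - s) - ((n + 1 : ℕ) : ℂ) ^ (1 - s)) / (s - 1)))]

lemma norm_sum_range_pow_le {z : ℂ} (hz : ‖z‖ ≤ 1) (hz1 : z ≠ 1) (m : ℕ) :
    ‖∑ n ∈ range m, z ^ n‖ ≤ 2 / ‖z - 1‖ := by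
  rw [geom_sum_eq hz1, norm_div]
  gcongr
  calc ‖z ^ m - 1‖ ≤ ‖z ^ m‖ + ‖(1 : ℂ)‖ := norm_sub_le _ _
    _ ≤ 1 + 1 := by
        rw [norm_pow, norm_one]
        gcongr
        exact pow_le_one₀ (norm_nonneg _) hz
    _ = 2 := by norm_num

lemma two_div_norm_stdAddChar_sub_one_le {d k : ℕ} [NeZero d] (hk0 : k ≠ 0) (hkd : k < d) :
    2 / ‖(ZMod.stdAddChar (k : ZMod d) : ℂ) - 1‖ ≤
      d / 2 * ((k : ℝ)⁻¹ + ((d - k : ℕ) : ℝ)⁻¹) := by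
  have hd0 : (0 : ℝ) < d := by exact_mod_cast Nat.pos_of_neZero d
  have hk : (0 : ℝ) < k := by exact_mod_cast Nat.pos_of_ne_zero hk0
  have hkd' : (k : ℝ) < d := by exact_mod_cast hkd
  have h1 : (ZMod.stdAddChar (k : ZMod d) : ℂ) =
      Complex.exp (Complex.I * ((2 * Real.pi * k / d : ℝ) : ℂ)) := by
    have := ZMod.stdAddChar_coe (N := d) (k : ℤ)
    rw [Int.cast_natCast] at this
    rw [this]
    congr 1
    push_cast
    ring
  rw [h1, Complex.norm_exp_I_mul_ofReal_sub_one, Nat.cast_sub hkd.le]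
  have h2 : (2 * Real.pi * k / d : ℝ) / 2 = Real.pi * (k / d) := by ring
  rw [h2]
  have hx : (k : ℝ) / d < 1 := (div_lt_one hd0).mpr hkd'
  have hx0 : 0 < (k : ℝ) / d := by positivity
  have hpi := Real.pi_pos
  have hsub : (0 : ℝ) < d - k := by linarith
  rcases le_total ((k : ℝ) / d) (1 / 2) with h | h
  · have h3 : 2 * ((k : ℝ) / d) ≤ Real.sin (Real.pi * (k / d)) := by
      have := Real.mul_le_sin (x := Real.pi * (k / d)) (by positivity) (by nlinarith)
      convert this using 1
      field_simp
    have h4 : 0 < 2 * ((k : ℝ) / d) := by positivity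
    rw [Real.norm_of_nonneg (by linarith)]
    calc 2 / (2 * Real.sin (Real.pi * (k / d))) ≤ 2 / (2 * (2 * ((k : ℝ) / d))) := by gcongr
      _ = d / 2 * (k : ℝ)⁻¹ := by field_simp
      _ ≤ _ := by
        gcongr
        have : (0 : ℝ) ≤ ((d : ℝ) - k)⁻¹ := by positivity
        linarith
  · have h3 : 2 * (1 - (k : ℝ) / d) ≤ Real.sin (Real.pi * (k / d)) := by
      have := Real.mul_le_sin (x := Real.pi * (1 - k / d)) (by nlinarith) (by nlinarith)
      rw [mul_sub, mul_one, Real.sin_pi_sub] at this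
      convert this using 1
      field_simp
    have h4 : 0 < 2 * (1 - (k : ℝ) / d) := by linarith
    rw [Real.norm_of_nonneg (by linarith)]
    calc 2 / (2 * Real.sin (Real.pi * (k / d))) ≤ 2 / (2 * (2 * (1 - (k : ℝ) / d))) := by gcongr
      _ = d / 2 * ((d : ℝ) - k)⁻¹ := by
        rw [one_sub_div hd0.ne']
        field_simp
      _ ≤ _ := by
        gcongr
        have : (0 : ℝ) ≤ (k : ℝ)⁻¹ := by positivity
        linarith

/-- The Pólya–Vinogradov inequality for a prime modulus. -/
lemma norm_sum_range_char_le_sqrt {d : ℕ} [Fact d.Prime] {χ : DirichletCharacter ℂ d}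
    (hχ : χ ≠ 1) (m : ℕ) :
    ‖∑ n ∈ range m, χ n‖ ≤ Real.sqrt d * (1 + Real.log d) := by
  have hd0 : (0 : ℝ) < d := by exact_mod_cast (Fact.out : d.Prime).pos
  set ψ : AddChar (ZMod d) ℂ := ZMod.stdAddChar with hψ
  have hχ' : χ⁻¹ ≠ 1 := by simpa using hχ
  have hτ : ‖gaussSum χ⁻¹ ψ‖ ^ 2 = d := by
    have h := gaussSum_mul_gaussSum_eq_card hχ' (ZMod.isPrimitive_stdAddChar d)
    rw [← star_gaussSum_eq, ZMod.card] at h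
    have h' := congrArg norm h
    rw [norm_mul, norm_star] at h'
    simpa [pow_two] using h'
  have hτ0 : ‖gaussSum χ⁻¹ ψ‖ = Real.sqrt d := by
    rw [← hτ, Real.sqrt_sq (norm_nonneg _)]
  have h1 : ∀ n : ℕ, χ n * gaussSum χ⁻¹ ψ = ∑ a : ZMod d, χ⁻¹ a * ψ a ^ n := by
    intro n
    have e1 : gaussSum χ⁻¹ (ψ.mulShift n) = ∑ a : ZMod d, χ⁻¹ a * ψ a ^ n := by
      refine sum_congr rfl fun a _ => ?_
      rw [AddChar.mulShift_apply, ← nsmul_eq_mul, AddChar.map_nsmul_eq_pow]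
    by_cases hn : (n : ZMod d) = 0
    · rw [← e1, hn]
      rw [MulChar.map_zero, zero_mul, AddChar.mulShift_zero, gaussSum_one_right hχ']
    · rw [← e1]
      have := gaussSum_mulShift_eq χ⁻¹ ψ (Units.mk0 (n : ZMod d) hn)
      simpa using this.symm
  have h2 : (∑ n ∈ range m, χ n) * gaussSum χ⁻¹ ψ =
      ∑ a : ZMod d, χ⁻¹ a * ∑ n ∈ range m, ψ a ^ n := by
    rw [sum_mul]
    simp_rw [h1, mul_sum]
    rw [sum_comm]
  have h3 : ∀ k ∈ range d, ‖χ⁻¹ (k : ZMod d) * ∑ n ∈ range m, ψ (k : ZMod d) ^ n‖ ≤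
      if k = 0 then 0 else d / 2 * ((k : ℝ)⁻¹ + ((d - k : ℕ) : ℝ)⁻¹) := by
    intro k hk
    split_ifs with hk0
    · subst hk0
      rw [Nat.cast_zero, MulChar.map_zero, zero_mul, norm_zero]
    · have hkd := mem_range.mp hk
      rw [norm_mul]
      have hne : (k : ZMod d) ≠ 0 := by
        rw [Ne, ZMod.natCast_eq_zero_iff]
        exact Nat.not_dvd_of_pos_of_lt (Nat.pos_of_ne_zero hk0) hkd
      have hψ1 : ψ (k : ZMod d) ≠ 1 := by
        intro h
        rw [← ψ.map_zero_eq_one] at h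
        exact hne (ZMod.injective_stdAddChar h)
      calc _ ≤ 1 * (2 / ‖ψ (k : ZMod d) - 1‖) := by
            gcongr
            · exact DirichletCharacter.norm_le_one _ _
            · exact norm_sum_range_pow_le (AddChar.norm_apply ψ _).le hψ1 m
        _ ≤ _ := by
            rw [one_mul]
            exact two_div_norm_stdAddChar_sub_one_le hk0 hkd
  have h4 : ‖(∑ n ∈ range m, χ n) * gaussSum χ⁻¹ ψ‖ ≤ d * (1 + Real.log d) := by
    rw [h2]
    have e : ∑ a : ZMod d, χ⁻¹ a * ∑ n ∈ range m, ψ a ^ n =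
        ∑ k ∈ range d, χ⁻¹ (k : ZMod d) * ∑ n ∈ range m, ψ (k : ZMod d) ^ n := by
      symm
      refine Finset.sum_nbij' (fun n : ℕ => (n : ZMod d)) ZMod.val ?_ ?_ ?_ ?_ ?_
      · simp
      · intro a _; simpa using ZMod.val_lt a
      · intro a ha; exact ZMod.val_cast_of_lt (by simpa using ha)
      · intro a _; simp
      · simp
    rw [e]
    refine (norm_sum_le _ _).trans ((sum_le_sum h3).trans ?_)
    obtain ⟨k, hk⟩ : ∃ k, d = k + 1 := ⟨d - 1, by have := (Fact.out : d.Prime).pos; omega⟩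
    have hH : ∑ i ∈ range k, (((i + 1 : ℕ) : ℝ))⁻¹ ≤ 1 + Real.log d := by
      have h5 : ∑ i ∈ range k, (((i + 1 : ℕ) : ℝ))⁻¹ ≤ (harmonic d : ℝ) := by
        rw [harmonic, hk, sum_range_succ]
        push_cast
        have : (0 : ℝ) ≤ ((k : ℝ) + 1)⁻¹ := by positivity
        linarith
      exact h5.trans (harmonic_le_one_add_log d)
    have h6 : ∑ i ∈ range d, (if i = 0 then (0 : ℝ) else
        d / 2 * ((i : ℝ)⁻¹ + ((d - i : ℕ) : ℝ)⁻¹)) =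
        d / 2 * (∑ i ∈ range k, (((i + 1 : ℕ) : ℝ))⁻¹ +
          ∑ i ∈ range k, (((d - (i + 1) : ℕ) : ℝ))⁻¹) := by
      conv_lhs => rw [show range d = range (k + 1) by rw [hk]]
      rw [sum_range_succ', ← sum_add_distrib, mul_sum]
      simp
    have h7 : ∑ i ∈ range k, (((d - (i + 1) : ℕ) : ℝ))⁻¹ =
        ∑ i ∈ range k, (((i + 1 : ℕ) : ℝ))⁻¹ := by
      rw [← sum_range_reflect]
      refine sum_congr rfl fun i hi => ?_
      have := mem_range.mp hi
      congr 2
      omega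
    rw [h6, h7]
    nlinarith
  rw [norm_mul, hτ0] at h4
  have hs : 0 < Real.sqrt d := Real.sqrt_pos.mpr hd0
  have h5 : (d : ℝ) * (1 + Real.log d) = Real.sqrt d * (1 + Real.log d) * Real.sqrt d := by
    linear_combination -(1 + Real.log d) * Real.mul_self_sqrt hd0.le
  rw [h5] at h4
  exact le_of_mul_le_mul_right h4 hs

/-- A character modulo `d ^ 2` with trivial square comes from a character modulo `d`. -/
lemma exists_char_of_sq_eq_one {d : ℕ} [Fact d.Prime] (hd : d ≠ 2)
    {χ : DirichletCharacter ℂ (d ^ 2)} (hχ : χ ≠ 1) (hχ2 : χ ^ 2 = 1) :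
    ∃ χ' : DirichletCharacter ℂ d, χ' ≠ 1 ∧ ∀ n : ℕ, χ n = χ' n := by
  have hp : d.Prime := Fact.out
  have : NeZero (d ^ 2) := ⟨pow_ne_zero 2 hp.ne_zero⟩
  have hdvd : d ∣ d ^ 2 := dvd_pow_self d two_ne_zero
  have hfac : χ.FactorsThrough d := by
    rw [DirichletCharacter.factorsThrough_iff_ker_unitsMap hdvd]
    intro u hu
    rw [MonoidHom.mem_ker] at hu ⊢
    have hpow : u ^ d = 1 := by
      have h1 : (ZMod.castHom hdvd (ZMod d)) (u : ZMod (d ^ 2)) = 1 := by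
        have := congrArg Units.val hu
        simpa [ZMod.unitsMap_def] using this
      obtain ⟨a, ha⟩ : ∃ a : ℤ, (a : ZMod (d ^ 2)) = u := ⟨_, ZMod.intCast_zmod_cast _⟩
      rw [← ha, map_intCast] at h1
      have h2 : a ≡ 1 [ZMOD d] := (ZMod.intCast_eq_intCast_iff _ _ _).mp (by simpa using h1)
      have h3 : a ^ d ≡ 1 [ZMOD (d ^ 2 : ℕ)] := by
        have h4 : (d : ℤ) ∣ a - 1 := by
          have := h2.symm.dvd
          simpa using this
        have h5 : (d : ℤ) ^ (1 + 1) ∣ a ^ d ^ 1 - 1 ^ d ^ 1 :=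
          dvd_sub_pow_of_dvd_sub h4 1
        rw [pow_one, one_pow] at h5
        exact (Int.modEq_iff_dvd.mpr (by push_cast; simpa using h5)).symm
      ext
      have h6 := (ZMod.intCast_eq_intCast_iff _ _ _).mpr h3
      push_cast at h6
      rw [Units.val_pow_eq_pow_val, ← ha]
      simpa using h6
    have hsq : χ.toUnitHom u ^ 2 = 1 := by
      ext
      have := congrArg (fun f : DirichletCharacter ℂ (d ^ 2) => f u) hχ2
      simp only [MulChar.pow_apply_coe, MulChar.one_apply_coe] at this
      simpa [MulChar.coe_toUnitHom] using this
    have hpow' : χ.toUnitHom u ^ d = 1 := by rw [← map_pow, hpow, map_one]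
    have hodd := hp.odd_of_ne_two hd
    obtain ⟨k, hk⟩ := hodd
    generalize χ.toUnitHom u = v at hsq hpow'
    rw [hk, pow_succ, pow_mul, hsq, one_pow, one_mul] at hpow'
    exact hpow'
  refine ⟨hfac.χ₀, ?_, ?_⟩
  · intro h
    apply hχ
    rw [hfac.eq_changeLevel, h]
    simp
  · intro n
    by_cases hn : n.Coprime d
    · have hu : IsUnit (n : ZMod (d ^ 2)) := by
        rw [ZMod.isUnit_iff_coprime]
        exact hn.pow_right 2
      conv_lhs => rw [hfac.eq_changeLevel]
      obtain ⟨u, hu'⟩ := hu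
      rw [← hu', DirichletCharacter.changeLevel_eq_cast_of_dvd, hu']
      simp [ZMod.cast_natCast hdvd]
    · rw [MulChar.map_nonunit, MulChar.map_nonunit]
      · rwa [ZMod.isUnit_iff_coprime]
      · rw [ZMod.isUnit_iff_coprime]
        rwa [Nat.coprime_pow_right_iff two_pos]

lemma eventually_norm_sum_range_char_le : ∀ᶠ d : ℕ in atTop, d.Prime →
    ∀ χ : DirichletCharacter ℂ (d ^ 2), χ ≠ 1 → χ ^ 2 = 1 →
      ∀ m, ‖∑ n ∈ range m, χ n‖ ≤ (d : ℝ) ^ (11 / 20 : ℝ) := by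
  filter_upwards [eventually_rpow_mul_log_le (show (1 / 2 : ℝ) < 11 / 20 by norm_num) 1 1,
    eventually_gt_atTop 2] with d hd hd2 hp χ hχ hχ2 m
  have : Fact d.Prime := ⟨hp⟩
  obtain ⟨χ', hχ', h⟩ := exists_char_of_sq_eq_one hd2.ne' hχ hχ2
  simp_rw [h]
  refine (norm_sum_range_char_le_sqrt hχ' m).trans ?_
  rw [Real.sqrt_eq_rpow]
  simpa using hd

/-- `1 / (e ^ v - 1) - 1 / v`, the bounded part of the Bose function. -/
noncomputable def boseRemainder (v : ℝ) : ℝ := (Real.exp v - 1)⁻¹ - v⁻¹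

lemma boseRemainder_nonpos {v : ℝ} (hv : 0 < v) : boseRemainder v ≤ 0 := by
  rw [boseRemainder, sub_nonpos]
  gcongr
  linarith [Real.add_one_le_exp v]

lemma neg_one_le_boseRemainder {v : ℝ} (hv : 0 < v) : -1 ≤ boseRemainder v := by
  have h1 : 0 < Real.exp v - 1 := by linarith [Real.add_one_lt_exp hv.ne']
  have h2 : (1 - v) * Real.exp v ≤ 1 := by
    have h3 : 1 - v ≤ Real.exp (-v) := by linarith [Real.add_one_le_exp (-v)]
    calc (1 - v) * Real.exp v ≤ Real.exp (-v) * Real.exp v := by gcongr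
      _ = 1 := by rw [← Real.exp_add]; simp
  have h4 : v⁻¹ - 1 ≤ (Real.exp v - 1)⁻¹ := by
    rw [inv_eq_one_div, inv_eq_one_div, le_div_iff₀ h1, div_sub_one hv.ne', div_mul_eq_mul_div,
      div_le_iff₀ hv]
    nlinarith
  rw [boseRemainder]
  linarith

lemma monotoneOn_boseRemainder : MonotoneOn boseRemainder (Set.Ioi 0) := by
  have hne : ∀ v : ℝ, 0 < v → Real.exp v - 1 ≠ 0 := fun v hv => by
    linarith [Real.add_one_lt_exp hv.ne']
  have hd : ∀ v : ℝ, 0 < v → HasDerivAt boseRemainder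
      (-Real.exp v / (Real.exp v - 1) ^ 2 - -(v ^ 2)⁻¹) v := fun v hv =>
    (((Real.hasDerivAt_exp v).sub_const 1).inv (hne v hv)).sub (hasDerivAt_inv hv.ne')
  refine monotoneOn_of_deriv_nonneg (convex_Ioi 0)
    (fun v hv => (hd v hv).continuousAt.continuousWithinAt)
    (fun v hv => (hd v (by simpa using hv)).differentiableAt.differentiableWithinAt) ?_
  intro v hv
  have hv : 0 < v := by simpa using hv
  rw [(hd v hv).deriv]
  have h1 : v / 2 ≤ Real.sinh (v / 2) := Real.self_le_sinh_iff.mpr (by linarith)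
  rw [Real.sinh_eq] at h1
  have h2 : Real.exp (v / 2) * Real.exp (-(v / 2)) = 1 := by rw [← Real.exp_add]; simp
  have h3 : Real.exp v = Real.exp (v / 2) ^ 2 := by rw [← Real.exp_nat_mul]; congr 1; ring
  have h4 : 0 < Real.exp (v / 2) := Real.exp_pos _
  have h5 : v * Real.exp (v / 2) ≤ Real.exp v - 1 := by
    rw [h3]
    nlinarith
  have h6 : 0 < v * Real.exp (v / 2) := by positivity
  have h7 : v ^ 2 * Real.exp v ≤ (Real.exp v - 1) ^ 2 := by
    rw [h3, ← mul_pow, ← h3]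
    gcongr
  have h8 : 0 < Real.exp v - 1 := by linarith
  have h9 : Real.exp v / (Real.exp v - 1) ^ 2 ≤ (v ^ 2)⁻¹ := by
    rw [inv_eq_one_div, div_le_div_iff₀ (by positivity) (by positivity)]
    linarith
  rw [neg_div]
  linarith

lemma zetaMul_apply {q : ℕ} (χ : DirichletCharacter ℂ q) (n : ℕ) :
    χ.zetaMul n = ∑ k ∈ n.divisors, χ k := by
  rw [DirichletCharacter.zetaMul, ArithmeticFunction.coe_zeta_mul_apply]
  refine sum_congr rfl fun k hk => ?_
  simp [toArithmeticFunction, (Nat.pos_of_mem_divisors hk).ne']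

open scoped ComplexOrder in
lemma one_le_zetaMul_sq {q : ℕ} {χ : DirichletCharacter ℂ q} (hχ : χ ^ 2 = 1) {k : ℕ}
    (hk : k ≠ 0) : 1 ≤ χ.zetaMul (k ^ 2) := by
  have hk2 : k ^ 2 ≠ 0 := pow_ne_zero 2 hk
  rw [χ.isMultiplicative_zetaMul.multiplicative_factorization _ hk2, Finsupp.prod]
  refine Finset.prod_induction _ (fun z : ℂ => 1 ≤ z) (fun a b => one_le_mul_of_one_le_of_one_le)
    le_rfl fun p hp => ?_
  have hp' : p.Prime := Nat.prime_of_mem_primeFactors hp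
  rw [Nat.factorization_pow, Finsupp.smul_apply, smul_eq_mul]
  generalize k.factorization p = j
  simp only [zetaMul_apply, Nat.sum_divisors_prime_pow hp', Nat.cast_pow, map_pow]
  rcases MulChar.isQuadratic_iff_sq_eq_one.mpr hχ p with h | h | h
  · rw [sum_range_succ']
    simp [h]
  · rw [h]
    simp only [one_pow, sum_const, card_range, nsmul_eq_mul, mul_one]
    push_cast
    have : (0 : ℂ) ≤ 2 * (j : ℂ) := by positivity
    simpa using this
  · simp only [h, neg_one_geom_sum]
    rw [if_neg (by simp)]

lemma hasSum_zetaMul_mul_pow {q : ℕ} (χ : DirichletCharacter ℂ q) {r : ℂ} (hr : ‖r‖ < 1) :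
    Summable (fun a : ℕ+ => χ (a : ℕ) * (r ^ (a : ℕ) / (1 - r ^ (a : ℕ)))) ∧
    HasSum (fun n : ℕ+ => χ.zetaMul n * r ^ (n : ℕ))
      (∑' a : ℕ+, χ (a : ℕ) * (r ^ (a : ℕ) / (1 - r ^ (a : ℕ)))) := by
  have hF : Summable fun c : ℕ+ × ℕ+ => χ (c.1 : ℕ) * r ^ (c.1 * c.2 : ℕ) := by
    refine Summable.of_norm_bounded (summable_prod_mul_pow 0 hr).norm fun c => ?_
    rw [norm_mul, pow_zero, one_mul]
    exact mul_le_of_le_one_left (norm_nonneg _) (χ.norm_le_one _)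
  have hgeo : ∀ a : ℕ+, HasSum (fun b : ℕ+ => χ (a : ℕ) * r ^ (a * b : ℕ))
      (χ (a : ℕ) * (r ^ (a : ℕ) / (1 - r ^ (a : ℕ)))) := by
    intro a
    have ha : ‖r ^ (a : ℕ)‖ < 1 := by
      rw [norm_pow]
      exact pow_lt_one₀ (norm_nonneg _) hr a.ne_zero
    have h := ((hasSum_geometric_of_norm_lt_one ha).mul_left (r ^ (a : ℕ))).mul_left (χ (a : ℕ))
    rw [← div_eq_mul_inv] at h
    refine (hasSum_pnat_iff_hasSum_succ (f := fun b => χ (a : ℕ) * r ^ (a * b : ℕ))).mpr ?_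
    have e : (fun b : ℕ => χ (a : ℕ) * r ^ (a * (b + 1) : ℕ)) =
        fun b => χ (a : ℕ) * (r ^ (a : ℕ) * (r ^ (a : ℕ)) ^ b) := by
      funext b
      rw [mul_add, pow_add, pow_mul, mul_one, mul_comm (r ^ (a : ℕ))]
    rw [e]
    exact h
  refine ⟨?_, ?_⟩
  · have := hF.prod
    rwa [funext fun a => (hgeo a).tsum_eq] at this
  have h1 : HasSum (fun c : ℕ+ × ℕ+ => χ (c.1 : ℕ) * r ^ (c.1 * c.2 : ℕ))
      (∑' a : ℕ+, χ (a : ℕ) * (r ^ (a : ℕ) / (1 - r ^ (a : ℕ)))) := by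
    have := hF.hasSum
    rwa [hF.tsum_prod, tsum_congr fun a => (hgeo a).tsum_eq] at this
  rw [← sigmaAntidiagonalEquivProd.hasSum_iff] at h1
  convert h1.sigma fun n => hasSum_fintype _ using 2 with n
  rw [zetaMul_apply, ← Nat.sum_divisorsAntidiagonal (fun i _ => χ i), sum_mul, univ_eq_attach,
    ← sum_attach]
  refine sum_congr rfl fun x _ => ?_
  have := (Nat.mem_divisorsAntidiagonal.mp x.2).1
  simp [sigmaAntidiagonalEquivProd, divisorsAntidiagonalFactors, this]

lemma sum_exp_le_re_tsum {q : ℕ} {χ : DirichletCharacter ℂ q} (hχ : χ ^ 2 = 1) {r : ℝ}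
    (hr0 : 0 ≤ r) (K : ℕ) {A : ℂ}
    (hA : HasSum (fun n : ℕ+ => χ.zetaMul n * (r : ℂ) ^ (n : ℕ)) A) :
    ∑ k ∈ range K, r ^ ((k + 1) ^ 2) ≤ A.re := by
  have h1 := Complex.hasSum_re hA
  have hre : ∀ n : ℕ+, (χ.zetaMul n * (r : ℂ) ^ (n : ℕ)).re = (χ.zetaMul n).re * r ^ (n : ℕ) := by
    intro n
    rw [← Complex.ofReal_pow, Complex.re_mul_ofReal]
  simp_rw [hre] at h1
  have hinj : Function.Injective fun k : ℕ => (k.succPNat) ^ 2 := by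
    intro a b h
    have h' := congrArg PNat.val h
    simp only [PNat.pow_coe, Nat.succPNat_coe] at h'
    have := Nat.pow_left_injective two_ne_zero h'
    omega
  calc ∑ k ∈ range K, r ^ ((k + 1) ^ 2)
      ≤ ∑ k ∈ range K, (χ.zetaMul ((k.succPNat ^ 2 : ℕ+) : ℕ)).re *
          r ^ ((k.succPNat ^ 2 : ℕ+) : ℕ) := by
        refine sum_le_sum fun k _ => ?_
        rw [PNat.pow_coe, Nat.succPNat_coe, Nat.succ_eq_add_one]
        refine le_mul_of_one_le_left (by positivity) ?_
        have := one_le_zetaMul_sq hχ (Nat.succ_ne_zero k)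
        exact (Complex.le_def.mp this).1
    _ = ∑ n ∈ (range K).map ⟨_, hinj⟩, (χ.zetaMul (n : ℕ)).re * r ^ (n : ℕ) := by
        rw [sum_map]; rfl
    _ ≤ A.re := by
        refine sum_le_hasSum _ (fun n _ => ?_) h1
        have := (Complex.le_def.mp (DirichletCharacter.zetaMul_nonneg hχ n)).1
        exact mul_nonneg this (by positivity)

lemma norm_tsum_sub_LFunction_le {q : ℕ} [NeZero q] {χ : DirichletCharacter ℂ q} (hχ : χ ≠ 1)
    {S : ℝ} (hS : ∀ m, ‖∑ n ∈ range m, χ n‖ ≤ S) {u : ℝ} (hu : 0 < u) {A : ℂ}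
    (hA : HasSum (fun n : ℕ+ => χ (n : ℕ) *
      (((Real.exp (-u) : ℝ) : ℂ) ^ (n : ℕ) / (1 - ((Real.exp (-u) : ℝ) : ℂ) ^ (n : ℕ)))) A) :
    ‖A - χ.LFunction 1 / u‖ ≤ 2 * S := by
  have hS0 : 0 ≤ S := (norm_nonneg _).trans (hS 0)
  have hlim : Tendsto (fun N : ℕ => ∑ n ∈ range N, χ n * (n : ℂ) ^ (-1 : ℂ)) atTop
      (𝓝 (χ.LFunction 1)) := by
    rw [tendsto_iff_norm_sub_tendsto_zero]
    have h0 : Tendsto (fun N : ℕ => 2 * S * (N : ℝ)⁻¹) atTop (𝓝 0) := by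
      simpa using (tendsto_inv_atTop_nhds_zero_nat (𝕜 := ℝ)).const_mul (2 * S)
    refine squeeze_zero' (Eventually.of_forall fun _ => norm_nonneg _) ?_ h0
    filter_upwards [eventually_ge_atTop 1] with N hN
    rw [norm_sub_rev]
    have := norm_LFunction_sub_sum_le hχ hS (s := 1) (by simp) hN
    simpa [Real.rpow_neg_one] using this
  have hA' := ((hasSum_pnat_iff (f := fun n : ℕ => χ n *
      (((Real.exp (-u) : ℝ) : ℂ) ^ n / (1 - ((Real.exp (-u) : ℝ) : ℂ) ^ n)))).mp hA).tendsto_sum_nat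
  simp only [pow_zero, sub_self, div_zero, mul_zero, add_zero] at hA'
  refine le_of_tendsto (hA'.sub (hlim.div_const (u : ℂ))).norm ?_
  filter_upwards [eventually_ge_atTop 1] with N hN
  have hterm : ∀ n : ℕ, 1 ≤ n → χ n * (((Real.exp (-u) : ℝ) : ℂ) ^ n /
      (1 - ((Real.exp (-u) : ℝ) : ℂ) ^ n)) - χ n * (n : ℂ) ^ (-1 : ℂ) / u =
      χ n * ((boseRemainder (n * u) : ℝ) : ℂ) := by
    intro n hn
    have hn0 : (0 : ℝ) < n := by exact_mod_cast hn
    have h1 : Real.exp (-u) ^ n / (1 - Real.exp (-u) ^ n) = (Real.exp (n * u) - 1)⁻¹ := by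
      rw [← Real.exp_nat_mul, mul_neg, Real.exp_neg]
      have := Real.exp_pos (n * u)
      have h2 := Real.add_one_lt_exp (x := n * u) (by positivity)
      have h3 : Real.exp (n * u) - 1 ≠ 0 := by nlinarith
      have h4 : 1 - (Real.exp (n * u))⁻¹ ≠ 0 := by
        intro h
        apply h3
        field_simp at h
        linarith
      field_simp
    have h5 := congrArg (fun x : ℝ => (x : ℂ)) h1
    push_cast at h5
    rw [boseRemainder]
    push_cast
    rw [h5, Complex.cpow_neg_one, mul_inv]
    ring
  have h2 : ∑ n ∈ range N, χ n * (((Real.exp (-u) : ℝ) : ℂ) ^ n /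
      (1 - ((Real.exp (-u) : ℝ) : ℂ) ^ n)) - (∑ n ∈ range N, χ n * (n : ℂ) ^ (-1 : ℂ)) / u =
      ∑ n ∈ Ico 1 N, χ n * ((boseRemainder (n * u) : ℝ) : ℂ) := by
    rw [sum_div, ← sum_sub_distrib, range_eq_Ico, sum_eq_sum_Ico_succ_bot (by omega)]
    have h0 : χ ((0 : ℕ) : ZMod q) * (((Real.exp (-u) : ℝ) : ℂ) ^ 0 /
      (1 - ((Real.exp (-u) : ℝ) : ℂ) ^ 0)) - χ ((0 : ℕ) : ZMod q) * ((0 : ℕ) : ℂ) ^ (-1 : ℂ) / u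
        = 0 := by simp
    rw [h0, zero_add]
    exact sum_congr rfl fun n hn => hterm n (mem_Ico.mp hn).1
  rw [h2]
  have hpos : ∀ n : ℕ, 1 ≤ n → 0 < (n : ℝ) * u := fun n hn => by
    have : (0 : ℝ) < n := by exact_mod_cast hn
    positivity
  have h3 := norm_sum_mul_le_of_partial_sums (c := fun n => χ n)
    (g := fun n => ((boseRemainder (n * u) : ℝ) : ℂ)) (S := 2 * S) (N := 1)
    (fun m hm => norm_sum_Ico_le_two_mul hS hm) hN
  refine h3.trans ?_
  have h4 : ∑ n ∈ Ico 1 N, ‖((boseRemainder ((n + 1 : ℕ) * u) : ℝ) : ℂ) -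
      ((boseRemainder (n * u) : ℝ) : ℂ)‖ = boseRemainder (N * u) - boseRemainder ((1 : ℕ) * u) := by
    have := sum_Ico_sub_succ (fun n : ℕ => boseRemainder (n * u)) hN
    rw [← neg_sub, ← this, ← sum_neg_distrib]
    refine sum_congr rfl fun n hn => ?_
    have hn1 := (mem_Ico.mp hn).1
    rw [← Complex.ofReal_sub, Complex.norm_real, Real.norm_of_nonneg]
    · ring
    · rw [sub_nonneg]
      refine monotoneOn_boseRemainder (hpos n hn1) (hpos _ (by omega)) ?_
      gcongr
      omega
  rw [h4, Complex.norm_real, Real.norm_of_nonpos (boseRemainder_nonpos (hpos N hN))]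
  have := neg_one_le_boseRemainder (hpos 1 le_rfl)
  nlinarith

lemma div_sq_le_norm_LFunction_one {q : ℕ} [NeZero q] {χ : DirichletCharacter ℂ q} (hχ : χ ≠ 1)
    (hχ2 : χ ^ 2 = 1) {S : ℝ} (hS : ∀ m, ‖∑ n ∈ range m, χ n‖ ≤ S) {K : ℕ} (hK : 1 ≤ K) :
    (K / 3 - 2 * S) / (K : ℝ) ^ 2 ≤ ‖χ.LFunction 1‖ := by
  have hK0 : (1 : ℝ) ≤ K := by exact_mod_cast hK
  set u : ℝ := 1 / (K : ℝ) ^ 2 with hu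
  have hu0 : 0 < u := by positivity
  have hr : Real.exp (-u) < 1 := by rw [Real.exp_lt_one_iff]; linarith
  have hr0 := (Real.exp_pos (-u)).le
  obtain ⟨h1, h2⟩ := hasSum_zetaMul_mul_pow χ (r := ((Real.exp (-u) : ℝ) : ℂ))
    (by rw [Complex.norm_real, Real.norm_of_nonneg hr0]; exact hr)
  have h3 := norm_tsum_sub_LFunction_le hχ hS hu0 h1.hasSum
  have h4 := sum_exp_le_re_tsum hχ2 hr0 K h2
  set A := ∑' a : ℕ+, χ (a : ℕ) *
    (((Real.exp (-u) : ℝ) : ℂ) ^ (a : ℕ) / (1 - ((Real.exp (-u) : ℝ) : ℂ) ^ (a : ℕ))) with hA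
  have h5 : (K : ℝ) / 3 ≤ ∑ k ∈ range K, Real.exp (-u) ^ ((k + 1) ^ 2) := by
    have : ∑ _k ∈ range K, (1 / 3 : ℝ) ≤ ∑ k ∈ range K, Real.exp (-u) ^ ((k + 1) ^ 2) := by
      refine sum_le_sum fun k hk => ?_
      have hk1 : ((k + 1 : ℕ) : ℝ) ≤ K := by exact_mod_cast mem_range.mp hk
      rw [← Real.exp_nat_mul]
      calc (1 / 3 : ℝ) ≤ Real.exp (-1) := by
            rw [Real.exp_neg, one_div]
            gcongr
            linarith [Real.exp_one_lt_d9]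
        _ ≤ _ := by
            gcongr
            rw [mul_neg, neg_le_neg_iff, hu, mul_one_div, div_le_one (by positivity)]
            push_cast
            push_cast at hk1
            gcongr
    simpa [div_eq_mul_inv] using this
  have h6 := Complex.re_le_norm A
  have h7 : ‖A‖ ≤ ‖A - χ.LFunction 1 / u‖ + ‖χ.LFunction 1 / u‖ := by
    simpa using norm_add_le (A - χ.LFunction 1 / u) (χ.LFunction 1 / u)
  have h8 : ‖χ.LFunction 1 / (u : ℂ)‖ = ‖χ.LFunction 1‖ * (K : ℝ) ^ 2 := by
    rw [norm_div, Complex.norm_real, Real.norm_of_nonneg hu0.le, hu]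
    field_simp
  rw [div_le_iff₀ (by positivity)]
  linarith

lemma eventually_le_norm_LFunction_one : ∀ᶠ d : ℕ in atTop, d.Prime → ∀ [NeZero (d ^ 2)],
    ∀ χ : DirichletCharacter ℂ (d ^ 2), χ ≠ 1 → χ ^ 2 = 1 →
      (d : ℝ) ^ (-(3 / 5) : ℝ) ≤ ‖χ.LFunction 1‖ := by
  filter_upwards [eventually_norm_sum_range_char_le, eventually_ge_atTop 1,
    eventually_rpow_mul_log_le (show (11 / 20 : ℝ) < 3 / 5 by norm_num) 78 0] with d hS hd1 hd hp _
      χ hχ hχ2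
  have hd0 : (1 : ℝ) ≤ d := by exact_mod_cast hd1
  set S : ℝ := (d : ℝ) ^ (11 / 20 : ℝ) with hSdef
  have hS1 : 1 ≤ S := Real.one_le_rpow hd0 (by norm_num)
  have hK1 := Nat.le_ceil (12 * S)
  have hK2 := Nat.ceil_lt_add_one (a := 12 * S) (by linarith)
  set K := ⌈12 * S⌉₊
  have hK : 1 ≤ K := by
    have : (1 : ℝ) ≤ K := by linarith
    exact_mod_cast this
  refine le_trans ?_ (div_sq_le_norm_LFunction_one hχ hχ2 (hS hp χ hχ hχ2) hK)
  rw [Real.rpow_neg (by linarith), le_div_iff₀ (by positivity), inv_mul_le_iff₀ (by positivity)]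
  have h1 : (K : ℝ) / 6 ≤ K / 3 - 2 * S := by linarith
  have h2 : 78 * S ≤ (d : ℝ) ^ (3 / 5 : ℝ) := by linarith
  calc (K : ℝ) ^ 2 = (6 * K) * (K / 6) := by ring
    _ ≤ (d : ℝ) ^ (3 / 5 : ℝ) * (K / 3 - 2 * S) := by
      gcongr
      linarith

lemma norm_LFunctionTrivChar_le {d : ℕ} (hd : d.Prime) [NeZero (d ^ 2)] {s : ℂ} (hs : 1 < s.re) :
    ‖DirichletCharacter.LFunctionTrivChar (d ^ 2) s‖ ≤ 2 * ‖riemannZeta s‖ := by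
  have hs1 : s ≠ 1 := by rintro rfl; simp at hs
  rw [DirichletCharacter.LFunctionTrivChar_eq_mul_riemannZeta hs1,
    Nat.primeFactors_prime_pow two_ne_zero hd, prod_singleton, norm_mul]
  gcongr
  refine (norm_sub_le _ _).trans ?_
  rw [norm_one, Complex.norm_natCast_cpow_of_pos hd.pos]
  have : (d : ℝ) ^ (-s).re ≤ 1 := Real.rpow_le_one_of_one_le_of_nonpos
    (by exact_mod_cast hd.one_lt.le) (by simp; linarith)
  linarith

lemma convex_reProdIm {s t : Set ℝ} (hs : Convex ℝ s) (ht : Convex ℝ t) :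
    Convex ℝ (s ×ℂ t) :=
  (hs.linear_preimage Complex.reLm).inter (ht.linear_preimage Complex.imLm)

/-- The `3-4-1` inequality gives a lower bound for an `L`-function slightly to the left of the
line `re s = 1` in terms of an upper bound for its derivative. -/
lemma two_mul_le_norm_LFunction {q : ℕ} [NeZero q] {χ : DirichletCharacter ℂ q} (hχ : χ ≠ 1)
    {η M P y : ℝ} (hη : 0 < η) (hM : 0 < M) (hP : 0 < P)
    (h0 : ‖DirichletCharacter.LFunctionTrivChar q (1 + η)‖ ≤ 16 / η)
    (h2 : ‖(χ ^ 2).LFunction (1 + η + 2 * Complex.I * y)‖ ≤ P)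
    (hder : ∀ s : ℂ, 1 - η ≤ s.re → s.re ≤ 1 + η → s.im = y → ‖deriv χ.LFunction s‖ ≤ M)
    (hsmall : 2 ^ 20 * η * M ^ 4 * P ≤ 1) {s : ℂ} (hs1 : 1 - η ≤ s.re) (hs2 : s.re ≤ 1 + η)
    (hy : s.im = y) : 2 * M * η ≤ ‖χ.LFunction s‖ := by
  have h1 := DirichletCharacter.norm_LFunction_product_ge_one (N := q) χ hη y
  rw [norm_mul, norm_mul, norm_pow, norm_pow] at h1
  set a := ‖χ.LFunction (1 + η + Complex.I * y)‖ with ha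
  have ha0 : 0 ≤ a := norm_nonneg _
  have h3 : 1 ≤ (16 / η) ^ 3 * a ^ 4 * P := by
    refine h1.le.trans ?_
    gcongr
  have h4 : 4 * M * η ≤ a := by
    by_contra! hlt
    have h5 : a ^ 4 < (4 * M * η) ^ 4 := by gcongr
    have h6 : (16 / η) ^ 3 * a ^ 4 * P < (16 / η) ^ 3 * (4 * M * η) ^ 4 * P := by gcongr
    have h7 : (16 / η) ^ 3 * (4 * M * η) ^ 4 * P = 2 ^ 20 * η * M ^ 4 * P := by
      field_simp
      norm_num
    linarith
  set z : ℂ := 1 + η + Complex.I * y with hz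
  have hzre : z.re = 1 + η := by simp [hz]
  have hzim : z.im = y := by simp [hz]
  have hconv : Convex ℝ (Set.Icc (1 - η) (1 + η) ×ℂ {y}) :=
    convex_reProdIm (convex_Icc _ _) (convex_singleton y)
  have hmv := hconv.norm_image_sub_le_of_norm_deriv_le (f := χ.LFunction) (C := M)
    (fun w _ => DirichletCharacter.differentiable_LFunction hχ w)
    (fun w hw => by
      rw [Complex.mem_reProdIm] at hw
      exact hder w hw.1.1 hw.1.2 hw.2)
    (x := s) (y := z) (by rw [Complex.mem_reProdIm]; exact ⟨⟨hs1, hs2⟩, hy⟩)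
    (by rw [Complex.mem_reProdIm]; exact ⟨⟨by linarith, by linarith⟩, hzim⟩)
  have hd : ‖z - s‖ ≤ 2 * η := by
    refine (Complex.norm_le_abs_re_add_abs_im _).trans ?_
    rw [Complex.sub_re, Complex.sub_im, hzre, hzim, hy, sub_self, abs_zero, add_zero, abs_le]
    constructor <;> linarith
  have h8 : M * ‖z - s‖ ≤ M * (2 * η) := by gcongr
  have h9 := norm_sub_norm_le (χ.LFunction z) (χ.LFunction s)
  linarith

lemma norm_LFunction_sub_le {q : ℕ} [NeZero q] {χ : DirichletCharacter ℂ q} (hχ : χ ≠ 1)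
    {η M ρ : ℝ} (hη : 0 ≤ η)
    (hder : ∀ s : ℂ, 1 - η ≤ s.re → s.re ≤ 1 + η → |s.im| ≤ ρ → ‖deriv χ.LFunction s‖ ≤ M)
    {s : ℂ} (hs1 : 1 - η ≤ s.re) (hs2 : s.re ≤ 1 + η)
    (hy : |s.im| ≤ ρ) : ‖χ.LFunction 1‖ - M * (η + ρ) ≤ ‖χ.LFunction s‖ := by
  have hρ : 0 ≤ ρ := (abs_nonneg _).trans hy
  have hconv : Convex ℝ (Set.Icc (1 - η) (1 + η) ×ℂ Set.Icc (-ρ) ρ) :=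
    convex_reProdIm (convex_Icc _ _) (convex_Icc _ _)
  have hmem : (1 : ℂ) ∈ Set.Icc (1 - η) (1 + η) ×ℂ Set.Icc (-ρ) ρ := by
    rw [Complex.mem_reProdIm]
    simp [hη, hρ]
  have hM : 0 ≤ M := (norm_nonneg _).trans (hder s hs1 hs2 hy)
  have hmv := hconv.norm_image_sub_le_of_norm_deriv_le (f := χ.LFunction) (C := M)
    (fun w _ => DirichletCharacter.differentiable_LFunction hχ w)
    (fun w hw => by
      rw [Complex.mem_reProdIm] at hw
      exact hder w hw.1.1 hw.1.2 (abs_le.mpr hw.2))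
    (x := s) (y := 1) (by rw [Complex.mem_reProdIm]; exact ⟨⟨hs1, hs2⟩, abs_le.mp hy⟩) hmem
  have hd : ‖1 - s‖ ≤ η + ρ := by
    refine (Complex.norm_le_abs_re_add_abs_im _).trans ?_
    rw [Complex.sub_re, Complex.sub_im, Complex.one_re, Complex.one_im, zero_sub, abs_neg]
    refine add_le_add (abs_le.mpr ?_) hy
    constructor <;> linarith
  have h8 : M * ‖1 - s‖ ≤ M * (η + ρ) := by gcongr
  have h9 := norm_sub_norm_le (χ.LFunction 1) (χ.LFunction s)
  linarith

lemma eventually_norm_LFunctionTrivChar_le : ∀ᶠ d : ℕ in atTop, d.Prime → ∀ [NeZero (d ^ 2)],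
    ∀ η y : ℝ, 0 < η → η ≤ 1 → (d : ℝ) ^ (-(67 / 100) : ℝ) ≤ |y| → |y| ≤ (d : ℝ) ^ 10 →
      ‖DirichletCharacter.LFunctionTrivChar (d ^ 2) (1 + η + 2 * Complex.I * y)‖ ≤
        (d : ℝ) ^ (68 / 100 : ℝ) := by
  filter_upwards [eventually_rpow_mul_log_le (show (67 / 100 : ℝ) < 68 / 100 by norm_num) 40 20,
    eventually_ge_atTop 1] with d hd hd1 hp _ η y hη hη1 hy1 hy2
  have hd0 : (1 : ℝ) ≤ d := by exact_mod_cast hd1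
  set s : ℂ := 1 + η + 2 * Complex.I * y with hs
  have hre : s.re = 1 + η := by simp [hs]
  have him : s.im = 2 * y := by simp [hs]
  have h1 := norm_LFunctionTrivChar_le hp (s := s) (by linarith)
  have h2 := norm_riemannZeta_le (s := s) (by linarith) (N := d ^ 10) (Nat.one_le_pow _ _ (by omega))
  have hb : 0 < (d : ℝ) ^ (-(67 / 100) : ℝ) := by positivity
  have h3 : 2 / ‖s - 1‖ ≤ (d : ℝ) ^ (67 / 100 : ℝ) := by
    have : 2 * (d : ℝ) ^ (-(67 / 100) : ℝ) ≤ ‖s - 1‖ := by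
      refine le_trans ?_ (Complex.abs_im_le_norm _)
      rw [Complex.sub_im, him, Complex.one_im, sub_zero, abs_mul, abs_two]
      linarith
    calc 2 / ‖s - 1‖ ≤ 2 / (2 * (d : ℝ) ^ (-(67 / 100) : ℝ)) := by gcongr
      _ = _ := by rw [Real.rpow_neg (by linarith)]; field_simp
  have h10 : (1 : ℝ) ≤ (d : ℝ) ^ 10 := one_le_pow₀ hd0
  have h4 : ‖s‖ ≤ 4 * (d : ℝ) ^ 10 := by
    refine (Complex.norm_le_abs_re_add_abs_im _).trans ?_
    rw [hre, him, abs_mul, abs_two, abs_of_nonneg (by linarith)]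
    linarith
  have h5 : 2 * ‖s‖ / ((d ^ 10 : ℕ) : ℝ) ≤ 8 := by
    rw [div_le_iff₀ (by push_cast; positivity)]
    push_cast
    linarith
  rw [Nat.cast_pow, Real.log_pow, ← Nat.cast_pow] at h2
  have h6 : (1 : ℝ) ≤ (d : ℝ) ^ (67 / 100 : ℝ) := Real.one_le_rpow hd0 (by norm_num)
  have h7 : 0 ≤ Real.log d := Real.log_nonneg hd0
  push_cast at h2 h5
  nlinarith

lemma norm_LFunctionTrivChar_one_add_le {d : ℕ} (hp : d.Prime) [NeZero (d ^ 2)] {η : ℝ}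
    (hη : 0 < η) (hη1 : η ≤ 1) :
    ‖DirichletCharacter.LFunctionTrivChar (d ^ 2) (1 + η)‖ ≤ 16 / η := by
  have hre : (1 + η : ℂ).re = 1 + η := by simp
  have h1 := norm_LFunctionTrivChar_le hp (s := 1 + η) (by linarith)
  have h2 := norm_riemannZeta_le (s := 1 + η) (by linarith) (N := 1) le_rfl
  have h3 : ‖(1 + η : ℂ) - 1‖ = η := by
    rw [add_sub_cancel_left, Complex.norm_real, Real.norm_of_nonneg hη.le]
  have h4 : ‖(1 + η : ℂ)‖ ≤ 2 := by
    refine (norm_add_le _ _).trans ?_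
    rw [norm_one, Complex.norm_real, Real.norm_of_nonneg hη.le]
    linarith
  rw [h3] at h2
  norm_num at h2
  have h5 : 1 ≤ 1 / η := by rw [le_div_iff₀ hη]; linarith
  have h6 : 16 / η = 16 * (1 / η) := by ring
  have h7 : 2 / η = 2 * (1 / η) := by ring
  rw [h7] at h2
  rw [h6]
  linarith

/-- Zero-free region with a bound for the logarithmic derivative. -/
lemma eventually_norm_logDeriv_LFunction_le : ∀ᶠ d : ℕ in atTop, d.Prime → ∀ [NeZero (d ^ 2)],
    ∀ χ : DirichletCharacter ℂ (d ^ 2), χ ≠ 1 → ∀ s : ℂ, 1 - (d : ℝ) ^ (-(9 / 10) : ℝ) ≤ s.re →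
      s.re ≤ 1 + (d : ℝ) ^ (-(9 / 10) : ℝ) → |s.im| ≤ (d : ℝ) ^ 10 →
      χ.LFunction s ≠ 0 ∧ ‖deriv χ.LFunction s / χ.LFunction s‖ ≤ d := by
  filter_upwards [eventually_norm_LFunction_le, eventually_norm_deriv_LFunction_le,
    eventually_le_norm_LFunction_one, eventually_norm_LFunctionTrivChar_le,
    eventually_rpow_mul_log_le (show (0 : ℝ) < 1 / 50 by norm_num) (2 ^ 20) 0,
    eventually_rpow_mul_log_le (show (0 : ℝ) < 9 / 10 by norm_num) 800 0,
    eventually_ge_atTop 1] with d hL hL' hL1 hL0 hc1 hc2 hd1 hp _ χ hχ s hs1 hs2 hs3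
  have hd0 : (1 : ℝ) ≤ d := by exact_mod_cast hd1
  have hdpos : (0 : ℝ) < d := by linarith
  have h10 : (1 : ℝ) ≤ (d : ℝ) ^ 10 := one_le_pow₀ hd0
  set η : ℝ := (d : ℝ) ^ (-(9 / 10) : ℝ) with hη
  set M : ℝ := (d : ℝ) ^ (1 / 20 : ℝ) with hM
  set P : ℝ := (d : ℝ) ^ (68 / 100 : ℝ) with hP
  have hη0 : 0 < η := by positivity
  have hM0 : 0 < M := by positivity
  have hP0 : 0 < P := by positivity
  simp only [zero_mul, add_zero, Real.rpow_zero, one_mul] at hc1 hc2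
  have hη1 : η ≤ 1 / 800 := by
    rw [hη, Real.rpow_neg hdpos.le, one_div]
    gcongr
  have hder : ∀ s : ℂ, 1 - η ≤ s.re → s.re ≤ 1 + η → |s.im| ≤ (d : ℝ) ^ 10 →
      ‖deriv χ.LFunction s‖ ≤ M := fun s h1 h2 h3 =>
    hL' χ hχ s (by linarith) (by linarith) (by linarith)
  have hsmall : 2 ^ 20 * η * M ^ 4 * P ≤ 1 := by
    have e : η * M ^ 4 * P = (d : ℝ) ^ (-(1 / 50) : ℝ) := by
      rw [hη, hM, hP, ← Real.rpow_natCast, ← Real.rpow_mul hdpos.le, ← Real.rpow_add hdpos,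
        ← Real.rpow_add hdpos]
      norm_num
    rw [mul_assoc, mul_assoc, ← mul_assoc η, e, Real.rpow_neg hdpos.le, ← div_eq_mul_inv,
      div_le_one (by positivity)]
    exact hc1
  have h0 := norm_LFunctionTrivChar_one_add_le hp hη0 (by linarith)
  have key : 2 * M * η ≤ ‖χ.LFunction s‖ := by
    by_cases hχ2 : χ ^ 2 = 1
    · rcases le_or_gt ((d : ℝ) ^ (-(67 / 100) : ℝ)) |s.im| with hρ | hρ
      · refine two_mul_le_norm_LFunction hχ hη0 hM0 hP0 h0 ?_
          (fun w h1 h2 h3 => hder w h1 h2 (by rwa [h3])) hsmall hs1 hs2 rfl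
        rw [hχ2]
        exact hL0 hp η s.im hη0 (by linarith) hρ hs3
      · have hρ1 : (d : ℝ) ^ (-(67 / 100) : ℝ) ≤ 1 :=
          Real.rpow_le_one_of_one_le_of_nonpos hd0 (by norm_num)
        have h1 := norm_LFunction_sub_le hχ hη0.le
          (fun w h1 h2 h3 => hder w h1 h2 (h3.trans (hρ1.trans h10))) hs1 hs2 hρ.le
        have h2 := hL1 hp χ hχ hχ2
        have h3 : η ≤ (d : ℝ) ^ (-(67 / 100) : ℝ) :=
          Real.rpow_le_rpow_of_exponent_le hd0 (by norm_num)
        have h4 : M * (d : ℝ) ^ (-(67 / 100) : ℝ) = (d : ℝ) ^ (-(3 / 5) : ℝ) *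
            (d : ℝ) ^ (-(1 / 50) : ℝ) := by
          rw [hM, ← Real.rpow_add hdpos, ← Real.rpow_add hdpos]
          norm_num
        have h5 : (d : ℝ) ^ (-(1 / 50) : ℝ) ≤ 1 / 100 := by
          rw [Real.rpow_neg hdpos.le, one_div (100 : ℝ)]
          exact inv_anti₀ (by norm_num) (by linarith)
        have h6 : 0 < (d : ℝ) ^ (-(3 / 5) : ℝ) := by positivity
        have h7 : M * η ≤ M * (d : ℝ) ^ (-(67 / 100) : ℝ) := by gcongr
        nlinarith
    · refine two_mul_le_norm_LFunction hχ hη0 hM0 hP0 h0 ?_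
        (fun w h1 h2 h3 => hder w h1 h2 (by rwa [h3])) hsmall hs1 hs2 rfl
      have hre : (1 + η + 2 * Complex.I * s.im : ℂ).re = 1 + η := by simp
      have him : (1 + η + 2 * Complex.I * s.im : ℂ).im = 2 * s.im := by simp
      refine (hL (χ ^ 2) hχ2 _ (by linarith) (by linarith) ?_).trans ?_
      · rw [him, abs_mul, abs_two]
        linarith
      · have : M ≤ P := Real.rpow_le_rpow_of_exponent_le hd0 (by norm_num)
        linarith
  have hpos : 0 < 2 * M * η := by positivity
  refine ⟨fun h => ?_, ?_⟩
  · rw [h, norm_zero] at key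
    linarith
  · rw [norm_div, div_le_iff₀ (by linarith)]
    have h1 := hder s hs1 hs2 hs3
    have h2 : 1 ≤ d * η := by
      rw [hη]
      nth_rewrite 1 [← Real.rpow_one (d : ℝ)]
      rw [← Real.rpow_add hdpos]
      exact Real.one_le_rpow hd0 (by norm_num)
    have h3 : (d : ℝ) * (2 * M * η) ≤ d * ‖χ.LFunction s‖ := by gcongr
    nlinarith

lemma norm_perron_kernel_le {c : ℝ} (hc : 1 ≤ c) (t : ℝ) :
    ‖1 / (((c : ℂ) + t * Complex.I) * (c + t * Complex.I + 1))‖ ≤ (1 + t ^ 2)⁻¹ := by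
  rw [norm_div, norm_one, norm_mul, one_div]
  have key (a : ℝ) (ha : 1 ≤ a) : √(1 + t ^ 2) ≤ ‖(a : ℂ) + t * Complex.I‖ := by
    rw [Complex.norm_add_mul_I]
    gcongr
    nlinarith
  have h1 := key c hc
  have h2 := key (c + 1) (by linarith)
  have h3 : (c : ℂ) + t * Complex.I + 1 = (c + 1 : ℝ) + t * Complex.I := by push_cast; ring
  rw [h3]
  refine inv_anti₀ (by positivity) ?_
  calc 1 + t ^ 2 = √(1 + t ^ 2) * √(1 + t ^ 2) := (Real.mul_self_sqrt (by positivity)).symm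
    _ ≤ _ := by gcongr

lemma continuous_perron_kernel {c : ℝ} (hc : 1 ≤ c) :
    Continuous fun t : ℝ => 1 / (((c : ℂ) + t * Complex.I) * (c + t * Complex.I + 1)) := by
  refine continuous_const.div (by fun_prop) fun t => mul_ne_zero ?_ ?_ <;>
  · intro h
    have := congrArg Complex.re h
    simp at this
    linarith

lemma integrable_perron_kernel {c : ℝ} (hc : 1 ≤ c) : MeasureTheory.Integrable
    fun t : ℝ => 1 / (((c : ℂ) + t * Complex.I) * (c + t * Complex.I + 1)) :=
  integrable_inv_one_add_sq.mono' (continuous_perron_kernel hc).aestronglyMeasurable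
    (.of_forall fun t => norm_perron_kernel_le hc t)

lemma hasMellin_max_one_sub {s : ℂ} (hs : 0 < s.re) :
    HasMellin (fun x : ℝ => ((max (1 - x) 0 : ℝ) : ℂ)) s (1 / (s * (s + 1))) := by
  have h1 := hasMellin_one_Ioc hs
  have h2 := hasMellin_cpow_Ioc 1 (s := s) (by simp; linarith)
  have h3 := hasMellin_sub h1.1 h2.1
  rw [h1.2, h2.2] at h3
  have hs0 : s ≠ 0 := by rintro rfl; simp at hs
  have hs1 : s + 1 ≠ 0 := by
    intro h
    have := congrArg Complex.re h
    simp at this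
    linarith
  have e : 1 / s - 1 / (s + 1) = 1 / (s * (s + 1)) := by field_simp; ring
  rw [e] at h3
  have hE : Set.EqOn (fun t : ℝ => Set.indicator (Set.Ioc 0 1) (fun _ => (1 : ℂ)) t -
      Set.indicator (Set.Ioc 0 1) (fun t : ℝ => (t : ℂ) ^ (1 : ℂ)) t)
      (fun x : ℝ => ((max (1 - x) 0 : ℝ) : ℂ)) (Set.Ioi 0) := by
    intro x hx
    have hx : 0 < x := hx
    by_cases h : x ≤ 1
    · have hm : x ∈ Set.Ioc (0 : ℝ) 1 := ⟨hx, h⟩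
      simp only [Set.indicator_of_mem hm]
      rw [max_eq_left (by linarith)]
      simp
    · have hm : x ∉ Set.Ioc (0 : ℝ) 1 := fun hm => h hm.2
      simp only [Set.indicator_of_notMem hm]
      rw [max_eq_right (by linarith)]
      simp
  refine ⟨?_, ?_⟩
  · refine (h3.1.congr_fun (fun x hx => ?_) measurableSet_Ioi)
    simp only [hE hx]
  · rw [← h3.2]
    refine MeasureTheory.setIntegral_congr_fun measurableSet_Ioi fun x hx => ?_
    simp only [← hE hx]

lemma mellinInv_perron_kernel {c x : ℝ} (hc : 1 ≤ c) (hx : 0 < x) :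
    mellinInv c (fun s => 1 / (s * (s + 1))) x = ((max (1 - x) 0 : ℝ) : ℂ) := by
  have hre (t : ℝ) : 0 < ((c : ℂ) + t * Complex.I).re := by simp; linarith
  have hv : MeasureTheory.Integrable fun t : ℝ =>
      mellin (fun x : ℝ => ((max (1 - x) 0 : ℝ) : ℂ)) (c + t * Complex.I) := by
    refine (integrable_perron_kernel hc).congr (.of_forall fun t => ?_)
    exact (hasMellin_max_one_sub (hre t)).2.symm
  have hcc : Continuous fun x : ℝ => ((max (1 - x) 0 : ℝ) : ℂ) := by fun_prop
  rw [← mellinInv_mellin_eq c (fun x : ℝ => ((max (1 - x) 0 : ℝ) : ℂ)) hx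
    (hasMellin_max_one_sub (by simp; linarith)).1 hv hcc.continuousAt]
  unfold mellinInv
  congr 1
  refine MeasureTheory.integral_congr_ae (.of_forall fun t => ?_)
  simp only [(hasMellin_max_one_sub (hre t)).2]

/-- The Perron formula with the weight `max (1 - n / y) 0`. -/
lemma sum_mul_max_eq_integral {a : ℕ → ℂ} (ha : a 0 = 0) {c y : ℝ} (hc : 1 ≤ c) (hy : 0 < y)
    (hs : LSeriesSummable a c) {N : ℕ} (hN : y ≤ N) :
    ∑ n ∈ range N, a n * ((max (1 - n / y) 0 : ℝ) : ℂ) = (1 / (2 * Real.pi) : ℝ) •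
      ∫ t : ℝ, LSeries a (c + t * Complex.I) * (y : ℂ) ^ ((c : ℂ) + t * Complex.I) *
        (1 / ((c + t * Complex.I) * (c + t * Complex.I + 1))) := by
  set k : ℝ → ℂ := fun t => 1 / (((c : ℂ) + t * Complex.I) * (c + t * Complex.I + 1)) with hk
  set F : ℕ → ℝ → ℂ := fun n t => LSeries.term a (c + t * Complex.I) n *
    (y : ℂ) ^ ((c : ℂ) + t * Complex.I) * k t with hF
  have hsum (t : ℝ) : LSeriesSummable a (c + t * Complex.I) :=
    hs.of_re_le_re (by simp)
  have hnorm (n : ℕ) (t : ℝ) : ‖F n t‖ = ‖LSeries.term a c n‖ * y ^ c * ‖k t‖ := by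
    rw [hF]
    simp only [norm_mul]
    rw [LSeries.norm_term_eq, LSeries.norm_term_eq, Complex.norm_cpow_eq_rpow_re_of_pos hy]
    simp
  have hFi (n : ℕ) : MeasureTheory.Integrable (F n) := by
    have hy' : (y : ℂ) ≠ 0 := by exact_mod_cast hy.ne'
    rcases eq_or_ne n 0 with rfl | hn
    · simp [hF]
    have hn' : (n : ℂ) ≠ 0 := by exact_mod_cast hn
    refine MeasureTheory.Integrable.mono' (g := fun t => ‖LSeries.term a c n‖ * y ^ c * ‖k t‖)
      ((integrable_perron_kernel hc).norm.const_mul _) ?_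
      (.of_forall fun t => (hnorm n t).le)
    refine Continuous.aestronglyMeasurable ?_
    refine Continuous.mul (Continuous.mul ?_ ?_) (continuous_perron_kernel hc)
    · simp only [LSeries.term_of_ne_zero hn]
      refine continuous_const.div ?_ fun t => ?_
      · exact Continuous.const_cpow (by fun_prop) (.inl hn')
      · exact (Complex.cpow_ne_zero_iff_of_exponent_ne_zero (fun h => by
          have := congrArg Complex.re h
          simp at this
          linarith)).mpr hn'
    · exact Continuous.const_cpow (by fun_prop) (.inl hy')
  have hsn : Summable fun n => ∫ t, ‖F n t‖ := by
    simp only [hnorm, MeasureTheory.integral_const_mul]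
    exact (hs.norm.mul_right _).mul_right _
  have h1 := MeasureTheory.hasSum_integral_of_summable_integral_norm hFi hsn
  have h2 : (∫ t, ∑' n, F n t) = ∫ t : ℝ, LSeries a (c + t * Complex.I) *
      (y : ℂ) ^ ((c : ℂ) + t * Complex.I) * k t := by
    refine MeasureTheory.integral_congr_ae (.of_forall fun t => ?_)
    simp only [hF, LSeries, tsum_mul_right]
  have h3 (n : ℕ) : (1 / (2 * Real.pi) : ℝ) • ∫ t, F n t =
      a n * ((max (1 - n / y) 0 : ℝ) : ℂ) := by
    rcases eq_or_ne n 0 with rfl | hn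
    · simp [hF, ha]
    have hn0 : (0 : ℝ) < n := by exact_mod_cast Nat.pos_of_ne_zero hn
    rw [← mellinInv_perron_kernel hc (div_pos hn0 hy), mellinInv, mul_smul_comm,
      ← MeasureTheory.integral_const_mul]
    congr 1
    refine MeasureTheory.integral_congr_ae (.of_forall fun t => ?_)
    simp only [hF, hk, LSeries.term_of_ne_zero hn, smul_eq_mul]
    rw [Complex.ofReal_div, Complex.ofReal_natCast, Complex.cpow_neg]
    have : ((n : ℂ) / y) ^ ((c : ℂ) + t * Complex.I) =
        (n : ℂ) ^ ((c : ℂ) + t * Complex.I) / (y : ℂ) ^ ((c : ℂ) + t * Complex.I) := by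
      have := Complex.div_cpow_ofReal_nonneg hn0.le hy.le ((c : ℂ) + t * Complex.I)
      simpa using this
    rw [this, inv_div]
    ring
  rw [h2] at h1
  have h4 := h1.const_smul (1 / (2 * Real.pi) : ℝ)
  simp only [h3] at h4
  rw [← h4.tsum_eq, tsum_eq_sum]
  intro n hn
  have : (N : ℝ) ≤ n := by exact_mod_cast not_lt.mp (fun h => hn (mem_range.mpr h))
  have : 1 ≤ n / y := by rw [le_div_iff₀ hy]; linarith
  rw [max_eq_right (by linarith)]
  simp

lemma arctan_le_self {x : ℝ} (hx : 0 ≤ x) : Real.arctan x ≤ x := by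
  have := Real.le_tan (Real.arctan_nonneg.mpr hx) (Real.arctan_lt_pi_div_two x)
  rwa [Real.tan_arctan] at this

lemma setIntegral_Ioi_inv_one_add_sq_le {R : ℝ} (hR : 0 < R) :
    ∫ t in Set.Ioi R, (1 + t ^ 2)⁻¹ ≤ 1 / R := by
  rw [integral_Ioi_inv_one_add_sq, ← Real.arctan_inv_of_pos hR, one_div]
  exact arctan_le_self (by positivity)

lemma setIntegral_Iic_inv_one_add_sq_le {R : ℝ} (hR : 0 < R) :
    ∫ t in Set.Iic (-R), (1 + t ^ 2)⁻¹ ≤ 1 / R := by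
  rw [integral_Iic_inv_one_add_sq, Real.arctan_neg, ← sub_eq_neg_add,
    ← Real.arctan_inv_of_pos hR, one_div]
  exact arctan_le_self (by positivity)

/-- Shifting the contour of a Perron integral to the left of the line `re s = 1`. -/
lemma norm_perron_integral_le {F : ℂ → ℂ} {η c R B K y : ℝ} (hη0 : 0 < η) (hη : η ≤ 1 / 2)
    (hc1 : 1 ≤ c) (hc2 : c ≤ 3 / 2) (hR : 0 < R) (hy : 1 ≤ y)
    (hF : DifferentiableOn ℂ F (Set.Icc (1 - η) c ×ℂ Set.Icc (-R) R))
    (hB : ∀ s ∈ Set.Icc (1 - η) c ×ℂ Set.Icc (-R) R, ‖F s‖ ≤ B)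
    (hK : ∀ t : ℝ, ‖F (c + t * Complex.I)‖ ≤ K) :
    ‖∫ t : ℝ, F (c + t * Complex.I) * (y : ℂ) ^ ((c : ℂ) + t * Complex.I) *
        (1 / ((c + t * Complex.I) * (c + t * Complex.I + 1)))‖ ≤
      2 * K * y ^ c / R + 4 * B * y ^ c / R ^ 2 + 4 * R * B * y ^ (1 - η) := by
  have hy0 : 0 < y := by linarith
  have hK0 : 0 ≤ K := (norm_nonneg _).trans (hK 0)
  have hB0 : 0 ≤ B := (norm_nonneg _).trans (hB c (by
    rw [Complex.mem_reProdIm]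
    simp
    constructor <;> linarith))
  set f : ℂ → ℂ := fun s => F s * (y : ℂ) ^ s * (1 / (s * (s + 1))) with hf
  change ‖∫ t : ℝ, f (c + t * Complex.I)‖ ≤ _
  by_cases hi : MeasureTheory.Integrable fun t : ℝ => f (c + t * Complex.I)
  swap
  · rw [MeasureTheory.integral_undef hi, norm_zero]
    positivity
  have hfn (s : ℂ) : ‖f s‖ = ‖F s‖ * y ^ s.re * (1 / (‖s‖ * ‖s + 1‖)) := by
    simp only [hf, norm_mul, norm_div, norm_one, Complex.norm_cpow_eq_rpow_re_of_pos hy0]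
  have hle (t : ℝ) : ‖f (c + t * Complex.I)‖ ≤ K * y ^ c * (1 + t ^ 2)⁻¹ := by
    simp only [hf]
    rw [norm_mul, norm_mul, Complex.norm_cpow_eq_rpow_re_of_pos hy0]
    have h1 := norm_perron_kernel_le hc1 t
    have h2 := hK t
    have h3 : ((c : ℂ) + t * Complex.I).re = c := by simp
    rw [h3]
    gcongr
  have hsplit : ∫ t : ℝ, f (c + t * Complex.I) =
      (∫ t in Set.Iic (-R), f (c + t * Complex.I)) + (∫ t in (-R)..R, f (c + t * Complex.I)) +
        ∫ t in Set.Ioi R, f (c + t * Complex.I) := by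
    rw [← intervalIntegral.integral_Iic_add_Ioi (b := R) hi.integrableOn hi.integrableOn,
      ← intervalIntegral.integral_Iic_sub_Iic (a := -R) hi.integrableOn hi.integrableOn,
      add_sub_cancel]
  have ht1 : ‖∫ t in Set.Iic (-R), f (c + t * Complex.I)‖ ≤ K * y ^ c * (1 / R) := by
    refine (MeasureTheory.norm_integral_le_of_norm_le
      (integrable_inv_one_add_sq.integrableOn.const_mul (K * y ^ c))
      (.of_forall hle)).trans ?_
    rw [MeasureTheory.integral_const_mul]
    gcongr
    exact setIntegral_Iic_inv_one_add_sq_le hR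
  have ht2 : ‖∫ t in Set.Ioi R, f (c + t * Complex.I)‖ ≤ K * y ^ c * (1 / R) := by
    refine (MeasureTheory.norm_integral_le_of_norm_le
      (integrable_inv_one_add_sq.integrableOn.const_mul (K * y ^ c))
      (.of_forall hle)).trans ?_
    rw [MeasureTheory.integral_const_mul]
    gcongr
    exact setIntegral_Ioi_inv_one_add_sq_le hR
  have hdiff : DifferentiableOn ℂ f (Set.Icc (1 - η) c ×ℂ Set.Icc (-R) R) := by
    intro s hs
    have hre : 0 < s.re := by
      rw [Complex.mem_reProdIm] at hs
      linarith [hs.1.1]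
    have h0 : s ≠ 0 := by rintro rfl; simp at hre
    have h1 : s + 1 ≠ 0 := by
      intro h
      have := congrArg Complex.re h
      simp at this
      linarith
    have hy' : (y : ℂ) ≠ 0 := by exact_mod_cast hy0.ne'
    refine ((hF s hs).mul (DifferentiableAt.differentiableWithinAt ?_)).mul
      (DifferentiableAt.differentiableWithinAt ?_)
    · exact differentiableAt_id.const_cpow (.inl hy')
    · exact (differentiableAt_const _).div (by fun_prop) (mul_ne_zero h0 h1)
  have hrect := Complex.integral_boundary_rect_eq_zero_of_differentiableOn f
    (⟨1 - η, -R⟩ : ℂ) (⟨c, R⟩ : ℂ) (by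
      simpa only [Set.uIcc_of_le (show 1 - η ≤ c by linarith),
        Set.uIcc_of_le (show -R ≤ R by linarith)] using hdiff)
  simp only [smul_eq_mul] at hrect
  have hhor (r : ℝ) (hr : |r| = R) : ‖∫ x in (1 - η)..c, f (x + r * Complex.I)‖ ≤
      B * y ^ c / R ^ 2 * 2 := by
    have h := intervalIntegral.norm_integral_le_of_norm_le_const (a := 1 - η) (b := c)
      (f := fun x : ℝ => f (x + r * Complex.I)) (C := B * y ^ c / R ^ 2) (fun x hx => by
        rw [Set.uIoc_of_le (by linarith)] at hx
        have hm : (x + r * Complex.I : ℂ) ∈ Set.Icc (1 - η) c ×ℂ Set.Icc (-R) R := by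
          rw [Complex.mem_reProdIm]
          simp only [Complex.add_re, Complex.ofReal_re, Complex.mul_re, Complex.I_re, mul_zero,
            Complex.ofReal_im, Complex.I_im, sub_self, add_zero, Complex.add_im,
            Complex.mul_im, mul_one, zero_add]
          exact ⟨⟨hx.1.le, hx.2⟩, abs_le.mp hr.le⟩
        have h1 := hB _ hm
        have h2 : R ≤ ‖(x + r * Complex.I : ℂ)‖ := by
          refine le_trans ?_ (Complex.abs_im_le_norm _)
          simp [hr]
        have h3 : R ≤ ‖(x + r * Complex.I + 1 : ℂ)‖ := by
          refine le_trans ?_ (Complex.abs_im_le_norm _)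
          simp [hr]
        have h4 : y ^ (x + r * Complex.I : ℂ).re ≤ y ^ c :=
          Real.rpow_le_rpow_of_exponent_le hy (by simpa using hx.2)
        have h5 : 1 / (‖(x + r * Complex.I : ℂ)‖ * ‖(x + r * Complex.I + 1 : ℂ)‖) ≤
            1 / R ^ 2 := by
          rw [sq]
          gcongr
        rw [hfn, div_eq_mul_one_div (B * y ^ c)]
        gcongr)
    refine h.trans ?_
    gcongr
    rw [abs_le]
    constructor <;> linarith
  have hleft : ‖∫ t in (-R)..R, f ((1 - η : ℝ) + t * Complex.I)‖ ≤
      B * y ^ (1 - η) * 2 * (2 * R) := by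
    have h := intervalIntegral.norm_integral_le_of_norm_le_const (a := -R) (b := R)
      (f := fun t : ℝ => f ((1 - η : ℝ) + t * Complex.I)) (C := B * y ^ (1 - η) * 2)
      (fun t ht => by
        rw [Set.uIoc_of_le (by linarith)] at ht
        have hre : ((1 - η : ℝ) + t * Complex.I : ℂ).re = 1 - η := by simp
        have him : ((1 - η : ℝ) + t * Complex.I : ℂ).im = t := by simp
        have hm : ((1 - η : ℝ) + t * Complex.I : ℂ) ∈ Set.Icc (1 - η) c ×ℂ Set.Icc (-R) R := by
          rw [Complex.mem_reProdIm, hre, him]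
          exact ⟨⟨le_rfl, by linarith⟩, ht.1.le, ht.2⟩
        have h1 := hB _ hm
        have h2 : 1 / 2 ≤ ‖((1 - η : ℝ) + t * Complex.I : ℂ)‖ := by
          refine le_trans ?_ (Complex.re_le_norm _)
          rw [hre]
          linarith
        have h3 : 1 ≤ ‖((1 - η : ℝ) + t * Complex.I + 1 : ℂ)‖ := by
          refine le_trans ?_ (Complex.re_le_norm _)
          rw [Complex.add_re, hre, Complex.one_re]
          linarith
        have h5 : 1 / (‖((1 - η : ℝ) + t * Complex.I : ℂ)‖ *
            ‖((1 - η : ℝ) + t * Complex.I + 1 : ℂ)‖) ≤ 2 := by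
          rw [div_le_iff₀ (by positivity)]
          nlinarith
        rw [hfn, hre]
        gcongr)
    refine h.trans ?_
    gcongr
    rw [abs_le]
    constructor <;> linarith
  have hmid : ‖∫ t in (-R)..R, f (c + t * Complex.I)‖ ≤
      B * y ^ c / R ^ 2 * 2 + B * y ^ c / R ^ 2 * 2 + B * y ^ (1 - η) * 2 * (2 * R) := by
    have e : Complex.I * ∫ t in (-R)..R, f (c + t * Complex.I) =
        (∫ x in (1 - η)..c, f (x + R * Complex.I)) -
        (∫ x in (1 - η)..c, f (x + (-R : ℝ) * Complex.I)) +
        Complex.I * ∫ t in (-R)..R, f ((1 - η : ℝ) + t * Complex.I) := by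
      linear_combination hrect
    have e' : ‖∫ t in (-R)..R, f (c + t * Complex.I)‖ =
        ‖Complex.I * ∫ t in (-R)..R, f (c + t * Complex.I)‖ := by
      rw [norm_mul, Complex.norm_I, one_mul]
    rw [e', e]
    refine (norm_add_le _ _).trans (add_le_add ((norm_sub_le _ _).trans (add_le_add ?_ ?_)) ?_)
    · exact hhor R (abs_of_pos hR)
    · exact hhor (-R) (by rw [abs_neg, abs_of_pos hR])
    · rw [norm_mul, Complex.norm_I, one_mul]
      exact hleft
  rw [hsplit]
  refine (norm_add₃_le).trans ((add_le_add (add_le_add ht1 hmid) ht2).trans (le_of_eq ?_))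
  field_simp
  ring

lemma tsum_one_div_rpow_le {a : ℝ} (ha : 0 < a) (ha1 : a ≤ 1) :
    ∑' n : ℕ, 1 / (n : ℝ) ^ (1 + a) ≤ 7 / a := by
  have hre : ((1 + a : ℝ) : ℂ).re = 1 + a := Complex.ofReal_re _
  have h1 := zeta_eq_tsum_one_div_nat_cpow (s := ((1 + a : ℝ) : ℂ)) (by rw [hre]; linarith)
  have h2 : riemannZeta ((1 + a : ℝ) : ℂ) = ((∑' n : ℕ, 1 / (n : ℝ) ^ (1 + a) : ℝ) : ℂ) := by
    rw [h1, Complex.ofReal_tsum]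
    refine tsum_congr fun n => ?_
    rw [Complex.ofReal_div, Complex.ofReal_cpow (Nat.cast_nonneg n)]
    simp
  have h3 := norm_riemannZeta_le (s := ((1 + a : ℝ) : ℂ)) (by rw [hre]; linarith) (N := 1) le_rfl
  rw [h2, Complex.norm_real] at h3
  have h4 : ‖((1 + a : ℝ) : ℂ) - 1‖ = a := by
    rw [Complex.ofReal_add, Complex.ofReal_one, add_sub_cancel_left, Complex.norm_real,
      Real.norm_of_nonneg ha.le]
  rw [h4, Complex.norm_real, Real.norm_of_nonneg (by positivity : 0 ≤ 1 + a)] at h3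
  refine (Real.le_norm_self _).trans (h3.trans ?_)
  rw [le_div_iff₀ ha]
  have : (1 + Real.log ((1 : ℕ) : ℝ) + 2 / a + 2 * (1 + a) / ((1 : ℕ) : ℝ)) * a =
      3 * a + 2 + 2 * a ^ 2 := by
    simp
    field_simp
    ring
  rw [this]
  nlinarith

lemma norm_LSeries_twist_vonMangoldt_le {q : ℕ} (χ : DirichletCharacter ℂ q) {δ : ℝ} (hδ : 0 < δ)
    (hδ1 : δ ≤ 1) {s : ℂ} (hs : s.re = 1 + δ) :
    ‖LSeries ((fun n : ℕ => χ n) * fun n => (ArithmeticFunction.vonMangoldt n : ℂ)) s‖ ≤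
      28 / δ ^ 2 := by
  have h1 := (DirichletCharacter.LSeriesSummable_twist_vonMangoldt χ (s := s) (by linarith)).norm
  have h2 : Summable fun n : ℕ => 2 / δ * (1 / (n : ℝ) ^ (1 + δ / 2)) :=
    (Real.summable_one_div_nat_rpow.mpr (by linarith)).mul_left _
  refine (norm_tsum_le_tsum_norm h1).trans ((h1.tsum_le_tsum (fun n => ?_) h2).trans ?_)
  · rw [LSeries.norm_term_eq]
    split_ifs with hn
    · positivity
    have hn0 : (0 : ℝ) < n := by exact_mod_cast Nat.pos_of_ne_zero hn
    rw [div_le_iff₀ (by positivity), Pi.mul_apply, norm_mul, Complex.norm_real,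
      Real.norm_of_nonneg ArithmeticFunction.vonMangoldt_nonneg, hs]
    have h3 : ArithmeticFunction.vonMangoldt n ≤ (n : ℝ) ^ (δ / 2) / (δ / 2) :=
      ArithmeticFunction.vonMangoldt_le_log.trans
        (Real.log_le_rpow_div hn0.le (by positivity))
    calc ‖χ n‖ * ArithmeticFunction.vonMangoldt n ≤ 1 * ((n : ℝ) ^ (δ / 2) / (δ / 2)) := by
          gcongr
          exact χ.norm_le_one _
      _ = _ := by
          have : (n : ℝ) ^ (1 + δ) = (n : ℝ) ^ (1 + δ / 2) * (n : ℝ) ^ (δ / 2) := by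
            rw [← Real.rpow_add hn0]
            ring_nf
          rw [this]
          field_simp
  · rw [tsum_mul_left]
    calc _ ≤ 2 / δ * (7 / (δ / 2)) := by
          gcongr
          exact tsum_one_div_rpow_le (by positivity) (by linarith)
      _ = _ := by field_simp; norm_num

lemma norm_sum_char_mul_vonMangoldt_le {q : ℕ} [NeZero q] {χ : DirichletCharacter ℂ q}
    (hχ : χ ≠ 1) {η R B y : ℝ} (hη0 : 0 < η) (hη : η ≤ 1 / 2) (hR : 0 < R) (hy : 1 < y)
    (hyη : 1 / Real.log y ≤ η)
    (hL : ∀ s : ℂ, 1 - η ≤ s.re → s.re ≤ 1 + η → |s.im| ≤ R →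
      χ.LFunction s ≠ 0 ∧ ‖deriv χ.LFunction s / χ.LFunction s‖ ≤ B) {N : ℕ} (hN : y ≤ N) :
    ‖∑ n ∈ range N, χ n * (ArithmeticFunction.vonMangoldt n * max (1 - n / y) 0 : ℝ)‖ ≤
      168 * Real.log y ^ 2 * y / R + 12 * B * y / R ^ 2 + 4 * R * B * y ^ (1 - η) := by
  have hlog : 0 < Real.log y := Real.log_pos hy
  set δ : ℝ := 1 / Real.log y with hδ
  have hδ0 : 0 < δ := by positivity
  set a : ℕ → ℂ := (fun n : ℕ => χ n) * fun n => (ArithmeticFunction.vonMangoldt n : ℂ) with ha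
  set F : ℂ → ℂ := fun s => -(deriv χ.LFunction s / χ.LFunction s) with hF
  have hyc : y ^ (1 + δ) ≤ 3 * y := by
    have : y ^ (1 + δ) = Real.exp 1 * y := by
      rw [Real.rpow_add (by linarith), Real.rpow_one, mul_comm]
      congr 1
      rw [Real.rpow_def_of_pos (by linarith), hδ, mul_one_div_cancel hlog.ne']
    rw [this]
    gcongr
    exact Real.exp_one_lt_three.le
  have hline (t : ℝ) : LSeries a ((1 + δ : ℝ) + t * Complex.I) =
      F ((1 + δ : ℝ) + t * Complex.I) := by
    have hre : 1 < ((1 + δ : ℝ) + t * Complex.I : ℂ).re := by simp [hδ0]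
    rw [ha, DirichletCharacter.LSeries_twist_vonMangoldt_eq χ hre, hF]
    simp only
    rw [DirichletCharacter.deriv_LFunction_eq_deriv_LSeries χ hre,
      DirichletCharacter.LFunction_eq_LSeries χ hre, neg_div]
  have hmem {s : ℂ} (hs : s ∈ Set.Icc (1 - η) (1 + δ) ×ℂ Set.Icc (-R) R) :
      1 - η ≤ s.re ∧ s.re ≤ 1 + η ∧ |s.im| ≤ R := by
    rw [Complex.mem_reProdIm] at hs
    exact ⟨hs.1.1, hs.1.2.trans (by linarith), abs_le.mpr hs.2⟩
  have hper := sum_mul_max_eq_integral (a := a) (by simp [ha]) (c := 1 + δ) (by linarith)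
    (show 0 < y by linarith)
    (DirichletCharacter.LSeriesSummable_twist_vonMangoldt χ (by simp [hδ0])) hN
  have hInt := norm_perron_integral_le (F := F) (c := 1 + δ) (B := B) (K := 28 / δ ^ 2) hη0 hη
    (by linarith) (by linarith) hR hy.le (fun s hs => by
      have hd := DirichletCharacter.differentiable_LFunction hχ
      obtain ⟨h1, h2, h3⟩ := hmem hs
      exact ((hd.deriv s).div (hd s) (hL s h1 h2 h3).1).neg.differentiableWithinAt)
    (fun s hs => by
      obtain ⟨h1, h2, h3⟩ := hmem hs
      rw [hF]
      simp only [norm_neg]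
      exact (hL s h1 h2 h3).2)
    (fun t => by
      rw [← hline]
      exact norm_LSeries_twist_vonMangoldt_le χ hδ0 (by linarith) (by simp))
  have hsum : ∑ n ∈ range N, χ n * (ArithmeticFunction.vonMangoldt n * max (1 - n / y) 0 : ℝ) =
      ∑ n ∈ range N, a n * ((max (1 - n / y) 0 : ℝ) : ℂ) := by
    refine sum_congr rfl fun n _ => ?_
    rw [ha, Pi.mul_apply, Complex.ofReal_mul, mul_assoc]
  simp only [hline] at hper
  rw [hsum, hper, norm_smul, Real.norm_of_nonneg (by positivity)]
  have hpi : 1 / (2 * Real.pi) ≤ 1 := by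
    rw [div_le_one (by positivity)]
    linarith [Real.pi_gt_three]
  have hB0 : 0 ≤ B := (norm_nonneg _).trans
    (hL 1 (by simp [hη0.le]) (by simp [hη0.le]) (by simp [hR.le])).2
  calc _ ≤ 1 * (2 * (28 / δ ^ 2) * y ^ (1 + δ) / R + 4 * B * y ^ (1 + δ) / R ^ 2 +
        4 * R * B * y ^ (1 - η)) := by gcongr
    _ ≤ 1 * (2 * (28 / δ ^ 2) * (3 * y) / R + 4 * B * (3 * y) / R ^ 2 +
        4 * R * B * y ^ (1 - η)) := by gcongr
    _ = _ := by
        rw [hδ]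
        field_simp
        ring

/-- Smoothed prime number theorem for nonprincipal characters modulo `d ^ 2`, in the range where
`d` is of size `log y`. -/
lemma eventually_norm_sum_char_mul_vonMangoldt_le {T : ℝ} (hT : 1 < T) :
    ∀ᶠ d : ℕ in atTop, d.Prime → ∀ [NeZero (d ^ 2)],
      ∀ χ : DirichletCharacter ℂ (d ^ 2), χ ≠ 1 → ∀ y : ℝ, T ^ d ≤ y → y ≤ 2 * T ^ d →
      ∀ N : ℕ, y ≤ N →
        ‖∑ n ∈ range N, χ n * (ArithmeticFunction.vonMangoldt n * max (1 - n / y) 0 : ℝ)‖ ≤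
          y / (d : ℝ) ^ 6 := by
  have hlT : 0 < Real.log T := Real.log_pos hT
  have hexp : ∀ᶠ d : ℕ in atTop,
      12 * (d : ℝ) ^ 17 ≤ Real.exp (Real.log T * (d : ℝ) ^ (1 / 10 : ℝ)) := by
    have h1 := ((isLittleO_pow_exp_pos_mul_atTop 170 hlT).const_mul_left 12).bound one_pos
    have h2 : Tendsto (fun d : ℕ => (d : ℝ) ^ (1 / 10 : ℝ)) atTop atTop :=
      (tendsto_rpow_atTop (by norm_num)).comp tendsto_natCast_atTop_atTop
    filter_upwards [h2.eventually h1] with d hd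
    have h3 : ((d : ℝ) ^ (1 / 10 : ℝ)) ^ 170 = (d : ℝ) ^ 17 := by
      rw [← Real.rpow_natCast, ← Real.rpow_mul (Nat.cast_nonneg d), ← Real.rpow_natCast]
      norm_num
    rw [h3, one_mul, Real.norm_of_nonneg (by positivity), Real.norm_of_nonneg (by positivity)]
      at hd
    exact hd
  filter_upwards [eventually_norm_logDeriv_LFunction_le, hexp, eventually_ge_atTop 3,
    eventually_rpow_mul_log_le (show (0 : ℝ) < 1 / 10 by norm_num) (1 / Real.log T) 0,
    eventually_rpow_mul_log_le (show (0 : ℝ) < 9 / 10 by norm_num) 2 0,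
    tendsto_natCast_atTop_atTop.eventually_ge_atTop (504 * (1 + Real.log T) ^ 2)]
    with d hL hexp hd3 hd1 hd2 hdT hp _ χ hχ y hy1 hy2 N hN
  have hd : (3 : ℝ) ≤ d := by exact_mod_cast hd3
  have hd0 : (0 : ℝ) < d := by linarith
  simp only [zero_mul, add_zero, Real.rpow_zero, one_mul] at hd1 hd2
  set η : ℝ := (d : ℝ) ^ (-(9 / 10) : ℝ) with hη
  have hη0 : 0 < η := by positivity
  have hη2 : η ≤ 1 / 2 := by
    rw [hη, Real.rpow_neg hd0.le, one_div (2 : ℝ)]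
    exact inv_anti₀ (by norm_num) hd2
  have hTd : 1 < T ^ d := one_lt_pow₀ hT (by omega)
  have hy : 1 < y := by linarith
  have hlog1 : d * Real.log T ≤ Real.log y := by
    rw [← Real.log_pow]
    exact Real.log_le_log (by linarith) hy1
  have hlog2 : Real.log y ≤ d * (1 + Real.log T) := by
    have h1 := Real.log_le_log (by linarith) hy2
    rw [Real.log_mul two_ne_zero (by linarith), Real.log_pow] at h1
    have := Real.log_two_lt_d9
    linarith
  have hdη : d * η = (d : ℝ) ^ (1 / 10 : ℝ) := by
    rw [hη]
    nth_rewrite 1 [← Real.rpow_one (d : ℝ)]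
    rw [← Real.rpow_add hd0]
    norm_num
  have hyη : 1 / Real.log y ≤ η := by
    have h1 : 1 / Real.log y ≤ 1 / (d * Real.log T) := by gcongr
    refine h1.trans ?_
    rw [div_le_iff₀ (by positivity)]
    rw [div_le_iff₀ hlT] at hd1
    calc 1 ≤ (d : ℝ) ^ (1 / 10 : ℝ) * Real.log T := hd1
      _ = _ := by rw [← hdη]; ring
  have h := norm_sum_char_mul_vonMangoldt_le hχ hη0 hη2 (R := (d : ℝ) ^ 10) (B := d)
    (by positivity) hy hyη (fun s => hL hp χ hχ s) hN
  have hy0 : 0 < y := by linarith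
  have h1 : 168 * Real.log y ^ 2 * y / (d : ℝ) ^ 10 ≤ y / (d : ℝ) ^ 6 / 3 := by
    have h2 : Real.log y ^ 2 ≤ (d * (1 + Real.log T)) ^ 2 := by
      have := Real.log_pos hy
      gcongr
    calc 168 * Real.log y ^ 2 * y / (d : ℝ) ^ 10
        ≤ 168 * (d * (1 + Real.log T)) ^ 2 * y / (d : ℝ) ^ 10 := by gcongr
      _ = (504 * (1 + Real.log T) ^ 2) * y / (3 * (d : ℝ) ^ 8) := by field_simp; ring
      _ ≤ d * y / (3 * (d : ℝ) ^ 8) := by gcongr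
      _ = y / (3 * d ^ 6) * (1 / d) := by field_simp
      _ ≤ y / (3 * d ^ 6) * 1 := by
          gcongr
          rw [div_le_one hd0]
          linarith
      _ = _ := by field_simp
  have h2 : 12 * (d : ℝ) * y / ((d : ℝ) ^ 10) ^ 2 ≤ y / (d : ℝ) ^ 6 / 3 := by
    calc 12 * (d : ℝ) * y / ((d : ℝ) ^ 10) ^ 2 = y / d ^ 6 / 3 * (36 / d ^ 13) := by
          field_simp
          norm_num
      _ ≤ y / d ^ 6 / 3 * 1 := by
          gcongr
          rw [div_le_one (by positivity)]
          calc (36 : ℝ) ≤ 3 ^ 13 := by norm_num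
            _ ≤ _ := by gcongr
      _ = _ := mul_one _
  have h3 : 4 * (d : ℝ) ^ 10 * d * y ^ (1 - η) ≤ y / (d : ℝ) ^ 6 / 3 := by
    have h4 : y ^ (1 - η) = y / y ^ η := by rw [Real.rpow_sub hy0, Real.rpow_one]
    have h5 : 12 * (d : ℝ) ^ 17 ≤ y ^ η := by
      refine hexp.trans ?_
      rw [Real.rpow_def_of_pos hy0, ← hdη, ← mul_assoc, mul_comm (Real.log T)]
      gcongr
    rw [h4]
    calc 4 * (d : ℝ) ^ 10 * d * (y / y ^ η) ≤ 4 * (d : ℝ) ^ 10 * d * (y / (12 * d ^ 17)) := by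
          gcongr
      _ = _ := by field_simp; norm_num
  linarith

/-- An upper bound for the central binomial coefficient in terms of the product of the primes
between `n` and `2 * n`. -/
lemma centralBinom_le_mul_prod_primes {n : ℕ} (hn : 2 < n) :
    n.centralBinom ≤ (2 * n) ^ Nat.sqrt (2 * n) * 4 ^ (2 * n / 3) *
      ∏ p ∈ Ioc n (2 * n) with p.Prime, p := by
  set f : ℕ → ℕ := fun x => x ^ n.centralBinom.factorization x with hf
  have hprime (s : Finset ℕ) : ∏ x ∈ s with x.Prime, f x = ∏ x ∈ s, f x := by
    refine prod_filter_of_ne fun p _ h => ?_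
    contrapose h
    rw [hf]
    simp only
    rw [Nat.factorization_eq_zero_of_not_prime n.centralBinom h, pow_zero]
  have hsplit : n.centralBinom = (∏ p ∈ range (2 * n / 3 + 1), f p) *
      ∏ p ∈ Ioc n (2 * n), f p := by
    conv_lhs => rw [← n.prod_pow_factorization_centralBinom]
    rw [← prod_union]
    · refine (prod_subset (fun p hp => ?_) fun p hp hp' => ?_).symm
      · simp only [mem_union, mem_range, mem_Ioc] at hp ⊢
        omega
      · simp only [mem_union, mem_range, mem_Ioc] at hp hp'
        by_cases h : p.Prime
        · rw [Nat.factorization_centralBinom_of_two_mul_self_lt_three_mul hn (by omega) (by omega),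
            pow_zero]
        · rw [Nat.factorization_eq_zero_of_not_prime n.centralBinom h, pow_zero]
    · rw [disjoint_left]
      intro p hp hp'
      simp only [mem_range, mem_Ioc] at hp hp'
      omega
  have hle_self {p : ℕ} (hp : p.Prime) (h : Nat.sqrt (2 * n) < p) : f p ≤ p := by
    refine (pow_right_mono₀ hp.one_lt.le ?_).trans (pow_one p).le
    exact Nat.factorization_choose_le_one (Nat.sqrt_lt'.mp h)
  rw [hsplit, ← hprime (range _), ← hprime (Ioc _ _)]
  refine Nat.mul_le_mul ?_ ?_
  · rw [← prod_filter_mul_prod_filter_not _ (· ≤ Nat.sqrt (2 * n))]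
    refine Nat.mul_le_mul ?_ ?_
    · refine (prod_le_prod' fun p _ => (?_ : f p ≤ 2 * n)).trans ?_
      · exact Nat.pow_factorization_choose_le (by omega)
      have : (Icc 1 (Nat.sqrt (2 * n))).card = Nat.sqrt (2 * n) := by
        rw [Nat.card_Icc, Nat.add_sub_cancel]
      rw [prod_const]
      refine pow_right_mono₀ (by omega) ((card_le_card fun x hx => ?_).trans this.le)
      obtain ⟨h1, h2⟩ := mem_filter.1 hx
      exact mem_Icc.mpr ⟨(mem_filter.1 h1).2.one_lt.le, h2⟩
    · refine le_trans ?_ (primorial_le_four_pow (2 * n / 3))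
      refine (prod_le_prod' fun p hp => (?_ : f p ≤ p)).trans ?_
      · obtain ⟨h1, h2⟩ := mem_filter.1 hp
        exact hle_self (mem_filter.1 h1).2 (not_le.1 h2)
      refine prod_le_prod_of_subset_of_one_le' (filter_subset _ _) ?_
      exact fun p hp _ => (mem_filter.1 hp).2.one_lt.le
  · refine prod_le_prod' fun p hp => ?_
    obtain ⟨h1, h2⟩ := mem_filter.1 hp
    refine hle_self h2 (lt_of_le_of_lt ?_ (mem_Ioc.1 h1).1)
    rw [← Nat.lt_add_one_iff, Nat.sqrt_lt']
    nlinarith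

/-- The Chebyshev lower bound for the primes between `n` and `2 * n`. -/
lemma mul_log_four_le_sum_log_primes {n : ℕ} (hn : 4 ≤ n) :
    (n : ℝ) / 3 * Real.log 4 ≤ Real.log n + √(2 * n) * Real.log (2 * n) +
      ∑ p ∈ Ioc n (2 * n) with p.Prime, Real.log p := by
  have h1 : 4 ^ n ≤ n * ((2 * n) ^ Nat.sqrt (2 * n) * 4 ^ (2 * n / 3) *
      ∏ p ∈ Ioc n (2 * n) with p.Prime, p) :=
    (Nat.four_pow_lt_mul_centralBinom n hn).le.trans
      (Nat.mul_le_mul_left _ (centralBinom_le_mul_prod_primes (by omega)))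
  have hn0 : (0 : ℝ) < n := by exact_mod_cast (show 0 < n by omega)
  have hP : ∀ p ∈ (Ioc n (2 * n)).filter Nat.Prime, (p : ℝ) ≠ 0 := fun p hp => by
    exact_mod_cast (mem_filter.1 hp).2.ne_zero
  have hP0 : ∏ p ∈ Ioc n (2 * n) with p.Prime, (p : ℝ) ≠ 0 := prod_ne_zero_iff.mpr hP
  have h2 : (4 : ℝ) ^ n ≤ n * ((2 * n) ^ Nat.sqrt (2 * n) * 4 ^ (2 * n / 3) *
      ∏ p ∈ Ioc n (2 * n) with p.Prime, (p : ℝ)) := by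
    have := (Nat.cast_le (α := ℝ)).mpr h1
    push_cast at this
    exact this
  have h3 := Real.log_le_log (by positivity) h2
  rw [Real.log_pow, Real.log_mul (by positivity) (by positivity),
    Real.log_mul (by positivity) hP0, Real.log_mul (by positivity) (by positivity),
    Real.log_pow, Real.log_pow, Real.log_prod hP] at h3
  have h4 : ((2 * n / 3 : ℕ) : ℝ) ≤ 2 * n / 3 := by
    refine Nat.cast_div_le.trans ?_
    push_cast
    rfl
  have h5 : ((Nat.sqrt (2 * n) : ℕ) : ℝ) ≤ √(2 * n) := by
    exact_mod_cast Real.nat_sqrt_le_real_sqrt (a := 2 * n)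
  have h6 : 0 < Real.log 4 := Real.log_pos (by norm_num)
  have h7 : 0 ≤ Real.log (2 * n) := Real.log_nonneg (by
    have : (4 : ℝ) ≤ n := by exact_mod_cast hn
    linarith)
  have h8 : ((2 * n / 3 : ℕ) : ℝ) * Real.log 4 ≤ 2 * n / 3 * Real.log 4 := by gcongr
  have h9 : ((Nat.sqrt (2 * n) : ℕ) : ℝ) * Real.log (2 * n) ≤ √(2 * n) * Real.log (2 * n) := by
    gcongr
  linarith

/-- `h` times the trapezoidal weight which is supported on `[x, 2 * x]` and equals `1` on
`[x + h, 2 * x - h]`. -/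
noncomputable def trapezoid (x h u : ℝ) : ℝ :=
  max (2 * x - u) 0 - max (2 * x - h - u) 0 - max (x + h - u) 0 + max (x - u) 0

lemma trapezoid_nonneg {x h : ℝ} (hh : 0 ≤ h) (hx : 2 * h ≤ x) (u : ℝ) : 0 ≤ trapezoid x h u := by
  unfold trapezoid
  grind

lemma trapezoid_le {x h : ℝ} (hh : 0 ≤ h) (hx : 2 * h ≤ x) (u : ℝ) : trapezoid x h u ≤ h := by
  unfold trapezoid
  grind

lemma trapezoid_eq_zero {x h u : ℝ} (hh : 0 ≤ h) (hx : 2 * h ≤ x) (hu : u ≤ x ∨ 2 * x ≤ u) :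
    trapezoid x h u = 0 := by
  unfold trapezoid
  grind

lemma trapezoid_eq {x h u : ℝ} (hh : 0 ≤ h) (hu : x + h ≤ u) (hu' : u ≤ 2 * x - h) :
    trapezoid x h u = h := by
  unfold trapezoid
  grind

lemma sum_le_sum_of_ne_zero_imp {ι : Type*} {s t : Finset ι} {f g : ι → ℝ}
    (hg : ∀ i ∈ t, 0 ≤ g i) (h : ∀ i ∈ s, f i ≠ 0 → i ∈ t ∧ f i ≤ g i) :
    ∑ i ∈ s, f i ≤ ∑ i ∈ t, g i := by
  classical
  rw [← sum_filter_ne_zero]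
  refine (sum_le_sum fun i hi => ?_).trans
    (sum_le_sum_of_subset_of_nonneg (fun i hi => ?_) fun i hi _ => hg i hi) <;>
  obtain ⟨h1, h2⟩ := mem_filter.1 hi
  · exact (h i h1 h2).2
  · exact (h i h1 h2).1

lemma mul_max_one_sub_div {y u : ℝ} (hy : 0 < y) : y * max (1 - u / y) 0 = max (y - u) 0 := by
  rw [mul_max_of_nonneg _ _ hy.le, mul_zero, mul_sub, mul_one, mul_div_cancel₀ _ hy.ne']

lemma norm_sum_char_mul_trapezoid_le {q : ℕ} {χ : DirichletCharacter ℂ q} {x h E : ℝ}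
    (hx0 : 0 < x) (hh : 0 ≤ h) (hx : 2 * h ≤ x) {N : ℕ}
    (hE : ∀ y : ℝ, x ≤ y → y ≤ 2 * x →
      ‖∑ n ∈ range N, χ n * (ArithmeticFunction.vonMangoldt n * max (1 - n / y) 0 : ℝ)‖ ≤ E) :
    ‖∑ n ∈ range N, χ n * (ArithmeticFunction.vonMangoldt n * trapezoid x h n : ℝ)‖ ≤
      8 * x * E := by
  set V : ℝ → ℂ := fun y =>
    ∑ n ∈ range N, χ n * (ArithmeticFunction.vonMangoldt n * max (1 - n / y) 0 : ℝ) with hV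
  have hVn (y : ℝ) (h1 : x ≤ y) (h2 : y ≤ 2 * x) : ‖(y : ℂ) * V y‖ ≤ 2 * x * E := by
    rw [norm_mul, Complex.norm_real, Real.norm_of_nonneg (by linarith)]
    have := hE y h1 h2
    gcongr
  have hVy (y : ℝ) (h1 : x ≤ y) : (y : ℂ) * V y =
      ∑ n ∈ range N, χ n * (ArithmeticFunction.vonMangoldt n * max (y - n) 0 : ℝ) := by
    rw [hV, mul_sum]
    refine sum_congr rfl fun n _ => ?_
    rw [← mul_max_one_sub_div (show 0 < y by linarith)]
    push_cast
    ring
  have e : ∑ n ∈ range N, χ n * (ArithmeticFunction.vonMangoldt n * trapezoid x h n : ℝ) =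
      ((2 * x : ℝ) : ℂ) * V (2 * x) - ((2 * x - h : ℝ) : ℂ) * V (2 * x - h) -
        ((x + h : ℝ) : ℂ) * V (x + h) + (x : ℂ) * V x := by
    rw [hVy _ (by linarith), hVy _ (by linarith), hVy _ (by linarith), hVy _ le_rfl,
      ← sum_sub_distrib, ← sum_sub_distrib, ← sum_add_distrib]
    refine sum_congr rfl fun n _ => ?_
    unfold trapezoid
    push_cast
    ring
  rw [e]
  have h1 := hVn (2 * x) (by linarith) le_rfl
  have h2 := hVn (2 * x - h) (by linarith) (by linarith)
  have h3 := hVn (x + h) (by linarith) (by linarith)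
  have h4 := hVn x le_rfl (by linarith)
  refine (norm_add_le _ _).trans ((add_le_add (norm_sub_le _ _) le_rfl).trans ?_)
  have h5 := norm_sub_le (((2 * x : ℝ) : ℂ) * V (2 * x)) (((2 * x - h : ℝ) : ℂ) * V (2 * x - h))
  linarith

lemma sum_log_primes_le_sum_trapezoid {x h : ℝ} (hx1 : 1 ≤ x) (hh : 0 ≤ h) (hx : 2 * h ≤ x) :
    h * ∑ p ∈ Ioc ⌊x⌋₊ (2 * ⌊x⌋₊) with p.Prime, Real.log p ≤
      ∑ p ∈ Ioc ⌊x⌋₊ (2 * ⌊x⌋₊) with p.Prime, Real.log p * trapezoid x h p +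
        h * (2 * h + 2) * Real.log (2 * x) := by
  set S := (Ioc ⌊x⌋₊ (2 * ⌊x⌋₊)).filter Nat.Prime with hS
  set A := Ioc ⌊x⌋₊ ⌊x + h⌋₊ with hA
  set B := Ioc ⌊2 * x - h⌋₊ ⌊2 * x⌋₊ with hB
  have hl : 0 ≤ Real.log (2 * x) := Real.log_nonneg (by linarith)
  have hcard (a b : ℝ) (ha : 0 ≤ a) (hab : a ≤ b) :
      ((Ioc ⌊a⌋₊ ⌊b⌋₊).card : ℝ) ≤ b - a + 1 := by
    rw [Nat.card_Ioc, Nat.cast_sub (Nat.floor_le_floor hab)]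
    have h1 := Nat.floor_le (ha.trans hab)
    have h2 := Nat.lt_floor_add_one a
    linarith
  have hA' := hcard x (x + h) (by linarith) (by linarith)
  have hB' := hcard (2 * x - h) (2 * x) (by linarith) (by linarith)
  have hmem {p : ℕ} (hp : p ∈ S) : x < p ∧ (p : ℝ) ≤ 2 * x ∧ p.Prime := by
    obtain ⟨h1, h2⟩ := mem_filter.1 hp
    obtain ⟨h3, h4⟩ := mem_Ioc.1 h1
    refine ⟨Nat.lt_of_floor_lt h3, ?_, h2⟩
    have h5 : (p : ℝ) ≤ 2 * ⌊x⌋₊ := by exact_mod_cast h4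
    have h6 := Nat.floor_le (show 0 ≤ x by linarith)
    linarith
  have key : ∑ p ∈ S, (h * Real.log p - Real.log p * trapezoid x h p) ≤
      ∑ p ∈ A ∪ B, h * Real.log (2 * x) := by
    refine sum_le_sum_of_ne_zero_imp (fun _ _ => by positivity) fun p hp hne => ⟨?_, ?_⟩
    · obtain ⟨h1, h2, -⟩ := hmem hp
      by_contra hn
      rw [mem_union, not_or, hA, hB, mem_Ioc, mem_Ioc] at hn
      refine hne ?_
      rw [trapezoid_eq hh]
      · ring
      · by_contra! hlt
        exact hn.1 ⟨(Nat.floor_lt (by linarith)).mpr h1, Nat.le_floor hlt.le⟩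
      · by_contra! hlt
        exact hn.2 ⟨(Nat.floor_lt (by linarith)).mpr hlt, Nat.le_floor h2⟩
    · obtain ⟨h1, h2, h3⟩ := hmem hp
      have h4 : 0 ≤ Real.log p := Real.log_nonneg (by linarith)
      have h5 : 0 ≤ Real.log p * trapezoid x h p := mul_nonneg h4 (trapezoid_nonneg hh hx _)
      have h6 : Real.log p ≤ Real.log (2 * x) := Real.log_le_log (by linarith) h2
      have h7 : h * Real.log p ≤ h * Real.log (2 * x) := by gcongr
      linarith
  rw [sum_sub_distrib, ← mul_sum, sum_const, nsmul_eq_mul] at key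
  have hAB : ((A ∪ B).card : ℝ) ≤ 2 * h + 2 := by
    have : ((A ∪ B).card : ℝ) ≤ A.card + B.card := by exact_mod_cast card_union_le A B
    linarith
  have : ((A ∪ B).card : ℝ) * (h * Real.log (2 * x)) ≤ (2 * h + 2) * (h * Real.log (2 * x)) := by
    gcongr
  linarith

/-- If the twisted sums of the von Mangoldt function by nonprincipal characters are small and there
is no prime in a residue class between `x` and `2 * x`, then there are few primes there. -/
lemma sum_log_primes_le_of_no_prime_modEq {q a : ℕ} [NeZero q] (ha : IsUnit (a : ZMod q))
    {x h E : ℝ} (hh : 0 ≤ h) (hx : 2 * h ≤ x) (hqx : (q : ℝ) ≤ x)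
    (hE0 : 0 ≤ E)
    (hE : ∀ χ : DirichletCharacter ℂ q, χ ≠ 1 → ∀ y : ℝ, x ≤ y → y ≤ 2 * x → ∀ N : ℕ, y ≤ N →
      ‖∑ n ∈ range N, χ n * (ArithmeticFunction.vonMangoldt n * max (1 - n / y) 0 : ℝ)‖ ≤ E)
    (hno : ∀ p : ℕ, p.Prime → x < p → (p : ℝ) < 2 * x → ¬ p ≡ a [MOD q]) :
    h * ∑ p ∈ Ioc ⌊x⌋₊ (2 * ⌊x⌋₊) with p.Prime, Real.log p ≤
      h * (2 * h + 2) * Real.log (2 * x) + q * (8 * x * E) +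
        q * (h * (2 * √(2 * x) * Real.log (2 * x))) := by
  have hq1 : (1 : ℝ) ≤ q := by exact_mod_cast Nat.one_le_iff_ne_zero.mpr (NeZero.ne q)
  have hx1 : 1 ≤ x := hq1.trans hqx
  set N := ⌊2 * x⌋₊ + 1 with hN
  have hNx : 2 * x ≤ N := by
    rw [hN]
    push_cast
    exact (Nat.lt_floor_add_one _).le
  set b : ℕ → ℝ := fun n => ArithmeticFunction.vonMangoldt n * trapezoid x h n with hb
  have hb0 (n : ℕ) : 0 ≤ b n :=
    mul_nonneg ArithmeticFunction.vonMangoldt_nonneg (trapezoid_nonneg hh hx _)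
  set S : DirichletCharacter ℂ q → ℂ := fun χ => ∑ n ∈ range N, χ n * (b n : ℂ) with hS
  have hSn (χ : DirichletCharacter ℂ q) (hχ : χ ≠ 1) : ‖S χ‖ ≤ 8 * x * E :=
    norm_sum_char_mul_trapezoid_le (by linarith) hh hx
      fun y h1 h2 => hE χ hχ y h1 h2 N (h2.trans hNx)
  have horth : ∑ χ : DirichletCharacter ℂ q, χ (a : ZMod q)⁻¹ * S χ =
      ((q.totient * ∑ n ∈ range N with ((n : ℕ) : ZMod q) = a, b n : ℝ) : ℂ) := by
    simp only [hS, mul_sum]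
    rw [sum_comm]
    simp only [← mul_assoc, ← sum_mul, DirichletCharacter.sum_char_inv_mul_char_eq ℂ ha]
    rw [sum_filter, Complex.ofReal_sum]
    refine sum_congr rfl fun n _ => ?_
    by_cases hn : (a : ZMod q) = n
    · rw [if_pos hn, if_pos hn.symm]
      simp only [hb]
      push_cast
      rfl
    · rw [if_neg hn, if_neg fun h => hn h.symm]
      simp
  have htot : (q.totient : ℝ) ≤ q := by exact_mod_cast Nat.totient_le q
  have hres : ∑ n ∈ range N with ((n : ℕ) : ZMod q) = a, b n ≤
      h * (2 * √(2 * x) * Real.log (2 * x)) := by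
    have h1 : ∑ n ∈ range N with ((n : ℕ) : ZMod q) = a, b n ≤
        ∑ n ∈ Ioc 0 ⌊2 * x⌋₊ with ¬ n.Prime, h * ArithmeticFunction.vonMangoldt n := by
      refine sum_le_sum_of_ne_zero_imp
        (fun _ _ => mul_nonneg hh ArithmeticFunction.vonMangoldt_nonneg) fun n hn hne => ⟨?_, ?_⟩
      · obtain ⟨h1, h2⟩ := mem_filter.1 hn
        have h3 : x < n ∧ (n : ℝ) < 2 * x := by
          by_contra hcon
          rw [not_and_or, not_lt, not_lt] at hcon
          exact hne (by rw [hb]; simp only; rw [trapezoid_eq_zero hh hx hcon, mul_zero])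
        rw [mem_filter, mem_Ioc]
        refine ⟨⟨?_, Nat.le_floor h3.2.le⟩, fun hp =>
          hno n hp h3.1 h3.2 ((ZMod.natCast_eq_natCast_iff _ _ _).mp h2)⟩
        exact_mod_cast (show (0 : ℝ) < n by linarith)
      · rw [mul_comm h]
        exact mul_le_mul_of_nonneg_left (trapezoid_le hh hx _)
          ArithmeticFunction.vonMangoldt_nonneg
    refine h1.trans ?_
    rw [← mul_sum, ← Chebyshev.psi_sub_theta_eq_sum_not_prime]
    gcongr
    exact Chebyshev.psi_sub_theta_le (by linarith)
  have hprinc : ∑ p ∈ Ioc ⌊x⌋₊ (2 * ⌊x⌋₊) with p.Prime, Real.log p * trapezoid x h p ≤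
      ‖S 1‖ := by
    set c : ℕ → ℝ := fun n => if IsUnit (n : ZMod q) then b n else 0 with hc
    have hS1 : S 1 = ((∑ n ∈ range N, c n : ℝ) : ℂ) := by
      simp only [hS, hc]
      push_cast
      refine sum_congr rfl fun n _ => ?_
      by_cases hn : IsUnit (n : ZMod q)
      · rw [MulChar.one_apply hn, if_pos hn, one_mul]
      · rw [MulChar.map_nonunit _ hn, if_neg hn, zero_mul, Complex.ofReal_zero]
    rw [hS1, Complex.norm_real]
    refine le_trans ?_ (Real.le_norm_self _)
    calc ∑ p ∈ Ioc ⌊x⌋₊ (2 * ⌊x⌋₊) with p.Prime, Real.log p * trapezoid x h p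
        = ∑ p ∈ Ioc ⌊x⌋₊ (2 * ⌊x⌋₊) with p.Prime, c p := by
          refine sum_congr rfl fun p hp => ?_
          obtain ⟨h1, h2⟩ := mem_filter.1 hp
          have h3 : x < p := Nat.lt_of_floor_lt (mem_Ioc.1 h1).1
          have hu : IsUnit (p : ZMod q) := by
            rw [ZMod.isUnit_iff_coprime, Nat.Prime.coprime_iff_not_dvd h2]
            intro hdvd
            have h4 := Nat.le_of_dvd (Nat.pos_of_ne_zero (NeZero.ne q)) hdvd
            have h5 : (p : ℝ) ≤ q := by exact_mod_cast h4
            linarith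
          simp only [hc, hb]
          rw [if_pos hu, ArithmeticFunction.vonMangoldt_apply_prime h2]
      _ ≤ ∑ n ∈ range N, c n := by
          refine sum_le_sum_of_subset_of_nonneg (fun p hp => ?_) fun n _ _ => ?_
          · have h1 := (mem_Ioc.1 (mem_filter.1 hp).1).2
            rw [mem_range, hN, Nat.lt_add_one_iff]
            refine Nat.le_floor ?_
            have h2 : (p : ℝ) ≤ 2 * ⌊x⌋₊ := by exact_mod_cast h1
            have h3 := Nat.floor_le (show 0 ≤ x by linarith)
            linarith
          · simp only [hc]
            split_ifs
            · exact hb0 n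
            · exact le_rfl
  have hmain : ‖S 1‖ ≤ q * (8 * x * E) + q * (h * (2 * √(2 * x) * Real.log (2 * x))) := by
    rw [← add_sum_erase _ _ (mem_univ (1 : DirichletCharacter ℂ q))] at horth
    have hinv : IsUnit (a : ZMod q)⁻¹ := by
      obtain ⟨u, hu⟩ := ha
      rw [← hu, ZMod.inv_coe_unit]
      exact u⁻¹.isUnit
    rw [MulChar.one_apply hinv, one_mul] at horth
    rw [eq_sub_of_add_eq horth]
    refine (norm_sub_le _ _).trans ?_
    rw [add_comm]
    refine add_le_add ?_ ?_
    · refine (norm_sum_le_of_le (n := fun _ => 8 * x * E) _ fun χ hχ => ?_).trans ?_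
      · rw [norm_mul]
        calc _ ≤ 1 * (8 * x * E) := by
              gcongr
              · exact χ.norm_le_one _
              · exact hSn χ (ne_of_mem_erase hχ)
          _ = _ := one_mul _
      · rw [sum_const, nsmul_eq_mul]
        gcongr
        refine le_trans ?_ (Nat.totient_le q)
        rw [← DirichletCharacter.card_eq_totient_of_hasEnoughRootsOfUnity ℂ q,
          Nat.card_eq_fintype_card]
        exact_mod_cast card_le_univ _
    · rw [Complex.norm_real, Real.norm_of_nonneg (mul_nonneg (Nat.cast_nonneg _)
        (sum_nonneg fun n _ => hb0 n))]
      exact mul_le_mul htot hres (sum_nonneg fun n _ => hb0 n) (Nat.cast_nonneg _)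
  have := sum_log_primes_le_sum_trapezoid hx1 hh hx
  linarith

lemma four_mul_lt_of_large {d x C Θ n : ℝ} (hC : 1 ≤ C) (hd : 24 * C + 51 < d)
    (hdx : 2 * d ^ 8 ≤ x) (hlog : Real.log (2 * x) ≤ d * C) (hnx : n ≤ x) (hn1 : x < n + 1)
    (hΘ : n / 3 * Real.log 4 ≤ Real.log n + √(2 * n) * Real.log (2 * n) + Θ) :
    x / d ^ 3 * (2 * (x / d ^ 3) + 2) * Real.log (2 * x) + d ^ 2 * (8 * x * (2 * x / d ^ 6)) +
        d ^ 2 * (x / d ^ 3 * (2 * √(2 * x) * Real.log (2 * x))) < x / d ^ 3 * Θ := by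
  have hd1 : 1 < d := by linarith
  have hd0 : 0 < d := by linarith
  have hd28 : d ^ 2 ≤ d ^ 8 := pow_le_pow_right₀ hd1.le (by norm_num)
  have hdx2 : d ^ 2 ≤ x := by nlinarith
  have hx2 : 2 ≤ x := by nlinarith [one_le_pow₀ (n := 8) hd1.le]
  have hx0 : 0 < x := by linarith
  set y := x / d with hy
  have hxy : x = y * d := by rw [hy]; field_simp
  have hy0 : 0 < y := by positivity
  have hdy : d ≤ y := by rw [hy, le_div_iff₀ hd0]; nlinarith
  have hsq : √(2 * x) ≤ x / d ^ 4 := by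
    rw [Real.sqrt_le_left (by positivity), div_pow, le_div_iff₀ (by positivity)]
    nlinarith
  have hl0 : 0 ≤ Real.log (2 * x) := Real.log_nonneg (by linarith)
  have hsl : √(2 * x) * Real.log (2 * x) ≤ y * C / d ^ 2 := by
    calc _ ≤ x / d ^ 4 * (d * C) := by gcongr
      _ = _ := by rw [hxy]; field_simp
  have hd2 : 1 ≤ d ^ 2 := one_le_pow₀ hd1.le
  have hyC : y * C / d ^ 2 ≤ y * C := div_le_self (by positivity) hd2
  have hlogn : Real.log n ≤ d * C := (Real.log_le_log (by linarith) (by linarith)).trans hlog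
  have hlogn2 : √(2 * n) * Real.log (2 * n) ≤ √(2 * x) * Real.log (2 * x) := by
    have h0 : 0 < 2 * n := by linarith
    have h1 : Real.log (2 * n) ≤ Real.log (2 * x) := Real.log_le_log h0 (by linarith)
    have h2 : √(2 * n) ≤ √(2 * x) := Real.sqrt_le_sqrt (by linarith)
    exact mul_le_mul h2 h1 (Real.log_nonneg (by linarith)) (Real.sqrt_nonneg _)
  have hlog4 : 1 ≤ Real.log 4 := by
    rw [Real.le_log_iff_exp_le (by norm_num)]
    linarith [Real.exp_one_lt_d9]
  have hn3 : n / 3 ≤ n / 3 * Real.log 4 := le_mul_of_one_le_right (by linarith) hlog4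
  have hdC : d * C ≤ y * C := by gcongr
  have hlow : x / 3 - (1 + 2 * (y * C)) ≤ Θ := by linarith
  have hbig : (24 * C + 51) * y < d * y := by gcongr
  have hy1 : 1 < y := by linarith
  have hΘ' : (6 * C + 16) * y < Θ := by nlinarith
  have hup : x / d ^ 3 * (2 * (x / d ^ 3) + 2) * Real.log (2 * x) +
      d ^ 2 * (8 * x * (2 * x / d ^ 6)) +
        d ^ 2 * (x / d ^ 3 * (2 * √(2 * x) * Real.log (2 * x))) =
      x / d ^ 3 * ((2 * (x / d ^ 3) + 2) * Real.log (2 * x) + 16 * y +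
        2 * (d ^ 2 * (√(2 * x) * Real.log (2 * x)))) := by
    rw [hy]
    field_simp
    ring
  rw [hup]
  refine mul_lt_mul_of_pos_left (lt_of_le_of_lt ?_ hΘ') (by positivity)
  have h1 : (2 * (x / d ^ 3) + 2) * Real.log (2 * x) ≤ 4 * (y * C) := by
    calc _ ≤ (2 * (x / d ^ 3) + 2) * (d * C) := by gcongr
      _ = 2 * (y * C / d) + 2 * (d * C) := by rw [hxy]; field_simp
      _ ≤ 2 * (y * C) + 2 * (y * C) := by
        have := div_le_self (show 0 ≤ y * C by positivity) hd1.le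
        linarith
      _ = _ := by ring
  have h2 : d ^ 2 * (√(2 * x) * Real.log (2 * x)) ≤ y * C := by
    calc _ ≤ d ^ 2 * (y * C / d ^ 2) := by gcongr
      _ = _ := by field_simp
  linarith

lemma eventually_two_mul_pow_le_pow {T : ℝ} (hT : 1 < T) (k : ℕ) :
    ∀ᶠ d : ℕ in atTop, 2 * (d : ℝ) ^ k ≤ T ^ d := by
  have h := (isLittleO_pow_const_const_pow_of_one_lt (R := ℝ) k hT).def
    (show (0 : ℝ) < 1 / 2 by norm_num)
  filter_upwards [h] with d hd
  rw [Real.norm_of_nonneg (by positivity), Real.norm_of_nonneg (by positivity)] at hd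
  linarith

end

/-- Fix `T > 1`. For every sufficiently large prime `d` there is a prime `p`
with `T^d < p < 2 T^d` and `p ≡ d − 1 (mod d²)`. -/
theorem stmt17 (T : ℝ) (hT : 1 < T) :
    ∃ D : ℕ, ∀ d : ℕ, d.Prime → D ≤ d →
      ∃ q : ℕ, q.Prime ∧ T ^ d < (q : ℝ) ∧ (q : ℝ) < 2 * T ^ d ∧
        q ≡ d - 1 [MOD d ^ 2] := by
  obtain ⟨D, hD⟩ := Filter.eventually_atTop.1 ((eventually_norm_sum_char_mul_vonMangoldt_le hT).and
    ((eventually_two_mul_pow_le_pow hT 8).and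
      (tendsto_natCast_atTop_atTop.eventually_gt_atTop (24 * (1 + Real.log T) + 51))))
  refine ⟨D, fun d hdp hd => ?_⟩
  obtain ⟨hsum, hpow, hbig⟩ := hD d hd
  have hlT : 0 < Real.log T := Real.log_pos hT
  have hd1 : (51 : ℝ) < d := by linarith
  have : NeZero (d ^ 2) := ⟨pow_ne_zero _ hdp.ne_zero⟩
  by_contra! hno
  set x := T ^ d with hx
  have hx0 : 0 < x := by positivity
  have hd8 : (d : ℝ) ^ 1 ≤ d ^ 8 := pow_le_pow_right₀ (by linarith) (by norm_num)
  have hd28 : (d : ℝ) ^ 2 ≤ d ^ 8 := pow_le_pow_right₀ (by linarith) (by norm_num)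
  have hlog : Real.log (2 * x) ≤ d * (1 + Real.log T) := by
    rw [Real.log_mul two_ne_zero hx0.ne', hx, Real.log_pow]
    linarith [Real.log_two_lt_d9]
  have hunit : IsUnit ((d - 1 : ℕ) : ZMod (d ^ 2)) := by
    rw [ZMod.isUnit_iff_coprime]
    refine Nat.Coprime.pow_right 2 ?_
    have := Nat.coprime_self_add_right (m := d - 1) (n := 1)
    rw [Nat.sub_add_cancel hdp.one_le] at this
    exact this.2 (Nat.coprime_one_right _)
  have hd3 : (2 : ℝ) ≤ d ^ 3 := by
    have : (d : ℝ) ^ 1 ≤ d ^ 3 := pow_le_pow_right₀ (by linarith) (by norm_num)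
    linarith
  have h1 := sum_log_primes_le_of_no_prime_modEq hunit (x := x) (h := x / d ^ 3)
    (E := 2 * x / d ^ 6) (by positivity)
    (by rw [mul_div_assoc', div_le_iff₀ (by positivity)]; nlinarith)
    (by push_cast; linarith) (by positivity)
    (fun χ hχ y h1 h2 N hN => (hsum hdp χ hχ y h1 h2 N hN).trans (by gcongr))
    (fun p hp h1 h2 => hno p hp h1 h2)
  have hn4 : 4 ≤ ⌊x⌋₊ := Nat.le_floor (by push_cast; linarith)
  have h2 := four_mul_lt_of_large (by linarith) hbig hpow hlog (Nat.floor_le hx0.le)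
    (Nat.lt_floor_add_one x) (mul_log_four_le_sum_log_primes hn4)
  push_cast at h1
  exact h1.not_gt h2
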